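/- Theorem (p,q-derivatives at the r-th level of full lifting): in the r-th level interpolating setup, assume additionally that p₀ > p₁ > … > p_r > 0, q₀ > q₁ > … > q_r > 0 and p_{k−1}q_{k−1} > p_kq_k for all 1 ≤ k ≤ r+1. Then for every k₁ ∈ {1,…,r}: dψ(X,Y,p,q,𝔪,β,s,t)/dp_{k₁} = (sign(s) s β/(2√n)) φ^{(k₁,p)} and dψ(X,Y,p,q,𝔪,β,s,t)/dq_{k₁} = (sign(s) s β/(2√n)) φ^{(k₁,q)}, where φ^{(k₁,p)} = −(1−t)(𝔪_{k₁}−𝔪_{k₁+1}) E_{G,𝒰_{r+1}}⟨‖x^{(i₁)}‖₂‖x^{(p₁)}‖₂ (y^{(p₂)})ᵀy^{(i₂)}⟩_{γ_{k₁+1}^{(r)}} − t q_{k₁}(𝔪_{k₁}−𝔪_{k₁+1}) E_{G,𝒰_{r+1}}⟨‖x^{(i₁)}‖₂‖x^{(p₁)}‖₂‖y^{(i₂)}‖₂‖y^{(p₂)}‖₂⟩_{γ_{k₁+1}^{(r)}} and φ^{(k₁,q)} = −(1−t)(𝔪_{k₁}−𝔪_{k₁+1}) E_{G,𝒰_{r+1}}⟨‖y^{(i₂)}‖₂‖y^{(p₂)}‖₂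 (x^{(i₁)})ᵀx^{(p₁)}⟩_{γ_{k₁+1}^{(r)}} − t p_{k₁}(𝔪_{k₁}−𝔪_{k₁+1}) E_{G,𝒰_{r+1}}⟨‖x^{(i₁)}‖₂‖x^{(p₁)}‖₂‖y^{(i₂)}‖₂‖y^{(p₂)}‖₂⟩_{γ_{k₁+1}^{(r)}}. -/

import Mathlib

set_option linter.unusedVariables false

open MeasureTheory Real

namespace SFLR

noncomputable section

/-- The sample space of one group `𝒰_k = (u^{(4,k)}, u^{(2,k)}, h^{(k)})`. -/
abbrev Us (m n : ℕ) : Type := ℝ × (Fin m → ℝ) × (Fin n → ℝ)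

/-- Standard Gaussian measure on `ℝ`. -/
def stdG : Measure ℝ := ProbabilityTheory.gaussianReal 0 1

/-- i.i.d. standard Gaussian vector measure. -/
def gVec (d : ℕ) : Measure (Fin d → ℝ) := Measure.pi fun _ => stdG

/-- i.i.d. standard Gaussian matrix measure. -/
def gMat (m n : ℕ) : Measure (Fin m → Fin n → ℝ) := Measure.pi fun _ => gVec n

/-- Law of one group `𝒰_k`. -/
def muU (m n : ℕ) : Measure (Us m n) := stdG.prod ((gVec m).prod (gVec n))

/-- Joint law of `(G, (𝒰_k)_{k=1}^{r+1})`; the `k`-th group `𝒰_k` is coordinate `k-1`. -/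
def muAll (r m n : ℕ) : Measure ((Fin m → Fin n → ℝ) × (Fin (r+1) → Us m n)) :=
  (gMat m n).prod (Measure.pi fun _ : Fin (r+1) => muU m n)

/-- Euclidean norm. -/
def nrm2 {d : ℕ} (v : Fin d → ℝ) : ℝ := Real.sqrt (∑ i, v i ^ 2)

/-- Euclidean inner product. -/
def dotv {d : ℕ} (a b : Fin d → ℝ) : ℝ := ∑ i, a i * b i

variable {m n l : ℕ}

/-- The `r`-th level interpolating exponent `D₀^{(i₁,i₂)}`; the factor `ε` multiplies the
`u^{(4,k)}`-terms (`ε = 1` gives `D₀`, `ε = 0` gives `D_{0,S}`). -/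
def D0R (r : ℕ) (ε β s t : ℝ) (mv p q : ℕ → ℝ) (x : Fin l → Fin n → ℝ) (y : Fin l → Fin m → ℝ)
    (G : Fin m → Fin n → ℝ) (U : Fin (r+1) → Us m n) (i1 i2 : Fin l) : ℝ :=
  Real.sqrt t * (∑ j, ∑ k, y i2 j * (G j k * x i1 k))
    + Real.sqrt (1 - t) * nrm2 (x i1) *
        (∑ j, y i2 j * (∑ k : Fin (r+1), Real.sqrt (p (k : ℕ) - p ((k : ℕ) + 1)) * (U k).2.1 j))
    + ε * (Real.sqrt t * nrm2 (x i1) * nrm2 (y i2) *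
        (∑ k : Fin (r+1),
          Real.sqrt (p (k : ℕ) * q (k : ℕ) - p ((k : ℕ) + 1) * q ((k : ℕ) + 1)) * (U k).1))
    + Real.sqrt (1 - t) * nrm2 (y i2) *
        (∑ kk, (∑ k : Fin (r+1), Real.sqrt (q (k : ℕ) - q ((k : ℕ) + 1)) * (U k).2.2 kk) * x i1 kk)

/-- `A^{(i₁,i₂)}`. -/
def AR (r : ℕ) (ε β s t : ℝ) (mv p q : ℕ → ℝ) (x : Fin l → Fin n → ℝ) (y : Fin l → Fin m → ℝ)
    (G : Fin m → Fin n → ℝ) (U : Fin (r+1) → Us m n) (i1 i2 : Fin l) : ℝ :=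
  Real.exp (β * D0R r ε β s t mv p q x y G U i1 i2)

/-- `C^{(i₁)}`. -/
def CR (r : ℕ) (ε β s t : ℝ) (mv p q : ℕ → ℝ) (x : Fin l → Fin n → ℝ) (y : Fin l → Fin m → ℝ)
    (G : Fin m → Fin n → ℝ) (U : Fin (r+1) → Us m n) (i1 : Fin l) : ℝ :=
  ∑ i2, AR r ε β s t mv p q x y G U i1 i2

/-- `Z`. -/
def ZR (r : ℕ) (ε β s t : ℝ) (mv p q : ℕ → ℝ) (x : Fin l → Fin n → ℝ) (y : Fin l → Fin m → ℝ)
    (G : Fin m → Fin n → ℝ) (U : Fin (r+1) → Us m n) : ℝ :=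
  ∑ i1, CR r ε β s t mv p q x y G U i1 ^ s

/-- `ζ_k`: successively integrated partition functions, `ζ₀ = Z`,
`ζ_k = E_{𝒰_k} ζ_{k-1}^{𝔪_k/𝔪_{k-1}}`. -/
def zetaR (r : ℕ) (ε β s t : ℝ) (mv p q : ℕ → ℝ) (x : Fin l → Fin n → ℝ)
    (y : Fin l → Fin m → ℝ) (G : Fin m → Fin n → ℝ) : ℕ → (Fin (r+1) → Us m n) → ℝ
  | 0, U => ZR r ε β s t mv p q x y G U
  | k+1, U =>
      if h : k < r + 1 then
        ∫ u, zetaR r ε β s t mv p q x y G k (Function.update U ⟨k, h⟩ u) ^ (mv (k+1) / mv k)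
          ∂ muU m n
      else 0

/-- The `r`-th level interpolating function `ψ`. -/
def psiR (r : ℕ) (ε β s t : ℝ) (mv p q : ℕ → ℝ) (x : Fin l → Fin n → ℝ)
    (y : Fin l → Fin m → ℝ) : ℝ :=
  ∫ ω, (β * |s| * Real.sqrt (n : ℝ) * mv r)⁻¹ *
      Real.log (zetaR r ε β s t mv p q x y ω.1 r ω.2) ∂ muAll r m n

/-- The operator `Φ_{𝒰_k}` (for `k ≥ 1`). -/
def PhiR (r : ℕ) (ε β s t : ℝ) (mv p q : ℕ → ℝ) (x : Fin l → Fin n → ℝ)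
    (y : Fin l → Fin m → ℝ) (k : ℕ)
    (f : (Fin m → Fin n → ℝ) → (Fin (r+1) → Us m n) → ℝ) :
    (Fin m → Fin n → ℝ) → (Fin (r+1) → Us m n) → ℝ :=
  fun G U =>
    if h : k - 1 < r + 1 then
      (∫ u, zetaR r ε β s t mv p q x y G (k-1) (Function.update U ⟨k-1, h⟩ u) ^ (mv k / mv (k-1))
          * f G (Function.update U ⟨k-1, h⟩ u) ∂ muU m n) /
        zetaR r ε β s t mv p q x y G k U
    else 0

/-- `Φ_{𝒰_hi} ∘ ⋯ ∘ Φ_{𝒰_lo}` (identity when `hi < lo`). -/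
def PhiUpToR (r : ℕ) (ε β s t : ℝ) (mv p q : ℕ → ℝ) (x : Fin l → Fin n → ℝ)
    (y : Fin l → Fin m → ℝ) (lo : ℕ) :
    ℕ → ((Fin m → Fin n → ℝ) → (Fin (r+1) → Us m n) → ℝ) →
      (Fin m → Fin n → ℝ) → (Fin (r+1) → Us m n) → ℝ
  | 0, f => f
  | hi+1, f =>
      if hi + 1 < lo then f
      else PhiR r ε β s t mv p q x y (hi+1) (PhiUpToR r ε β s t mv p q x y lo hi f)

/-- `γ₀(i₁,i₂)`. -/
def gam0R (r : ℕ) (ε β s t : ℝ) (mv p q : ℕ → ℝ) (x : Fin l → Fin n → ℝ)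
    (y : Fin l → Fin m → ℝ) (i1 i2 : Fin l) :
    (Fin m → Fin n → ℝ) → (Fin (r+1) → Us m n) → ℝ :=
  fun G U =>
    CR r ε β s t mv p q x y G U i1 ^ s / ZR r ε β s t mv p q x y G U *
      (AR r ε β s t mv p q x y G U i1 i2 / CR r ε β s t mv p q x y G U i1)

/-- The measure `γ_{k₁+1}^{(r)}`. -/
def gamR (r : ℕ) (ε β s t : ℝ) (mv p q : ℕ → ℝ) (x : Fin l → Fin n → ℝ)
    (y : Fin l → Fin m → ℝ) (k1 : ℕ) (i1 i2 pp1 pp2 : Fin l) :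
    (Fin m → Fin n → ℝ) → (Fin (r+1) → Us m n) → ℝ :=
  PhiUpToR r ε β s t mv p q x y (k1+1) r
    (fun G U =>
      PhiUpToR r ε β s t mv p q x y 1 k1 (gam0R r ε β s t mv p q x y i1 i2) G U *
        PhiUpToR r ε β s t mv p q x y 1 k1 (gam0R r ε β s t mv p q x y pp1 pp2) G U)

/-- The measure `γ₀₁^{(r)}`. -/
def gam01R (r : ℕ) (ε β s t : ℝ) (mv p q : ℕ → ℝ) (x : Fin l → Fin n → ℝ)
    (y : Fin l → Fin m → ℝ) (i1 i2 : Fin l) :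
    (Fin m → Fin n → ℝ) → (Fin (r+1) → Us m n) → ℝ :=
  PhiUpToR r ε β s t mv p q x y 1 r (gam0R r ε β s t mv p q x y i1 i2)

/-- The measure `γ₀₂^{(r)}`. -/
def gam02R (r : ℕ) (ε β s t : ℝ) (mv p q : ℕ → ℝ) (x : Fin l → Fin n → ℝ)
    (y : Fin l → Fin m → ℝ) (i1 i2 p2 : Fin l) :
    (Fin m → Fin n → ℝ) → (Fin (r+1) → Us m n) → ℝ :=
  PhiUpToR r ε β s t mv p q x y 1 r
    (fun G U =>
      gam0R r ε β s t mv p q x y i1 i2 G U * gam0R r ε β s t mv p q x y i1 p2 G U)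

/-- `E_{G,𝒰_{r+1}} ⟨f⟩_{γ_{k₁+1}^{(r)}}`. -/
def EBrR (r : ℕ) (ε β s t : ℝ) (mv p q : ℕ → ℝ) (x : Fin l → Fin n → ℝ)
    (y : Fin l → Fin m → ℝ) (k1 : ℕ) (f : Fin l → Fin l → Fin l → Fin l → ℝ) : ℝ :=
  ∫ ω, (∑ i1, ∑ i2, ∑ pp1, ∑ pp2,
      f i1 i2 pp1 pp2 * gamR r ε β s t mv p q x y k1 i1 i2 pp1 pp2 ω.1 ω.2) ∂ muAll r m n

/-- `E_{G,𝒰_{r+1}} ⟨f⟩_{γ₀₁^{(r)}}`. -/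
def EB01R (r : ℕ) (ε β s t : ℝ) (mv p q : ℕ → ℝ) (x : Fin l → Fin n → ℝ)
    (y : Fin l → Fin m → ℝ) (f : Fin l → Fin l → ℝ) : ℝ :=
  ∫ ω, (∑ i1, ∑ i2, f i1 i2 * gam01R r ε β s t mv p q x y i1 i2 ω.1 ω.2) ∂ muAll r m n

/-- `E_{G,𝒰_{r+1}} ⟨f⟩_{γ₀₂^{(r)}}`. -/
def EB02R (r : ℕ) (ε β s t : ℝ) (mv p q : ℕ → ℝ) (x : Fin l → Fin n → ℝ)
    (y : Fin l → Fin m → ℝ) (f : Fin l → Fin l → Fin l → ℝ) : ℝ :=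
  ∫ ω, (∑ i1, ∑ i2, ∑ p2, f i1 i2 p2 * gam02R r ε β s t mv p q x y i1 i2 p2 ω.1 ω.2)
    ∂ muAll r m n

/-- `E_{G,𝒰_{r+1}} ⟨‖x^{(i₁)}‖‖x^{(p₁)}‖‖y^{(i₂)}‖‖y^{(p₂)}‖⟩_{γ_{k₁+1}^{(r)}}`. -/
def EXR (r : ℕ) (ε β s t : ℝ) (mv p q : ℕ → ℝ) (x : Fin l → Fin n → ℝ)
    (y : Fin l → Fin m → ℝ) (k1 : ℕ) : ℝ :=
  EBrR r ε β s t mv p q x y k1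
    (fun i1 i2 pp1 pp2 => nrm2 (x i1) * nrm2 (x pp1) * nrm2 (y i2) * nrm2 (y pp2))

/-- The corrected interpolating function `ψ₁`. -/
def psi1R (r : ℕ) (ε β s t : ℝ) (mv p q : ℕ → ℝ) (x : Fin l → Fin n → ℝ)
    (y : Fin l → Fin m → ℝ) : ℝ :=
  -(Real.sign s * s * β / (2 * Real.sqrt (n : ℝ))) *
      (∑ k ∈ Finset.range (r+1),
        mv (k+1) * (p k * q k * EXR r ε β s t mv p q x y k
          - p (k+1) * q (k+1) * EXR r ε β s t mv p q x y (k+1)))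
    + psiR r ε β s t mv p q x y

/-- The component `u_j^{(2,k)}`. -/
def u2c {r m n : ℕ} (U : Fin (r+1) → Us m n) (k : ℕ) (j : Fin m) : ℝ :=
  if h : k - 1 < r + 1 then (U ⟨k-1, h⟩).2.1 j else 0

/-- The scalar `u^{(4,k)}`. -/
def u4c {r m n : ℕ} (U : Fin (r+1) → Us m n) (k : ℕ) : ℝ :=
  if h : k - 1 < r + 1 then (U ⟨k-1, h⟩).1 else 0

/-- `u^{(i₁,3,k)} = (h^{(k)})ᵀ x^{(i₁)} / ‖x^{(i₁)}‖₂`. -/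
def u3c {r m n l : ℕ} (x : Fin l → Fin n → ℝ) (U : Fin (r+1) → Us m n) (k : ℕ)
    (i1 : Fin l) : ℝ :=
  if h : k - 1 < r + 1 then dotv (U ⟨k-1, h⟩).2.2 (x i1) / nrm2 (x i1) else 0

/-- The nested conditional expectations
`E_{𝒰_v}(ζ_{v-1}^{𝔪_v/𝔪_{v-1}-1} ⋯ E_{𝒰₁}(ζ₀^{𝔪₁/𝔪₀-1} g) ⋯)`. -/
def nestR (r : ℕ) (ε β s t : ℝ) (mv p q : ℕ → ℝ) (x : Fin l → Fin n → ℝ)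
    (y : Fin l → Fin m → ℝ) (g : (Fin m → Fin n → ℝ) → (Fin (r+1) → Us m n) → ℝ) :
    ℕ → (Fin m → Fin n → ℝ) → (Fin (r+1) → Us m n) → ℝ
  | 0 => g
  | v+1 => fun G U =>
      if h : v < r + 1 then
        ∫ u, zetaR r ε β s t mv p q x y G v (Function.update U ⟨v, h⟩ u) ^
              (mv (v+1) / mv v - 1) *
            nestR r ε β s t mv p q x y g v G (Function.update U ⟨v, h⟩ u) ∂ muU m n
      else 0

/-- `T^p_{k,1,j}(i₁,i₂)` at the `r`-th level. -/
def TpR (r : ℕ) (ε β s t : ℝ) (mv p q : ℕ → ℝ) (x : Fin l → Fin n → ℝ)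
    (y : Fin l → Fin m → ℝ) (k : ℕ) (j : Fin m) (i1 i2 : Fin l) : ℝ :=
  ∫ ω, (zetaR r ε β s t mv p q x y ω.1 r ω.2)⁻¹ *
      nestR r ε β s t mv p q x y
        (fun G U => CR r ε β s t mv p q x y G U i1 ^ (s - 1) *
          AR r ε β s t mv p q x y G U i1 i2 * y i2 j * u2c U k j) r ω.1 ω.2 ∂ muAll r m n

/-- `T^q_{k,2}(i₁,i₂)` at the `r`-th level. -/
def TqR (r : ℕ) (ε β s t : ℝ) (mv p q : ℕ → ℝ) (x : Fin l → Fin n → ℝ)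
    (y : Fin l → Fin m → ℝ) (k : ℕ) (i1 i2 : Fin l) : ℝ :=
  ∫ ω, (zetaR r ε β s t mv p q x y ω.1 r ω.2)⁻¹ *
      nestR r ε β s t mv p q x y
        (fun G U => CR r ε β s t mv p q x y G U i1 ^ (s - 1) *
          AR r ε β s t mv p q x y G U i1 i2 * u3c x U k i1) r ω.1 ω.2 ∂ muAll r m n

/-- `T^{(p,q)}_{k,3}(i₁,i₂)` at the `r`-th level. -/
def TpqR (r : ℕ) (ε β s t : ℝ) (mv p q : ℕ → ℝ) (x : Fin l → Fin n → ℝ)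
    (y : Fin l → Fin m → ℝ) (k : ℕ) (i1 i2 : Fin l) : ℝ :=
  ∫ ω, (zetaR r ε β s t mv p q x y ω.1 r ω.2)⁻¹ *
      nestR r ε β s t mv p q x y
        (fun G U => CR r ε β s t mv p q x y G U i1 ^ (s - 1) *
          AR r ε β s t mv p q x y G U i1 i2 * u4c U k) r ω.1 ω.2 ∂ muAll r m n

set_option linter.unusedSectionVars false

section part1
/-! ### Functions with (locally uniform) exponential growth -/
section growth

variable {P Z Z' X V W : Type}
  [NormedAddCommGroup P] [NormedSpace ℝ P]
  [NormedAddCommGroup Z] [NormedSpace ℝ Z]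
  [NormedAddCommGroup Z'] [NormedSpace ℝ Z']
  [NormedAddCommGroup X] [NormedSpace ℝ X]

/-- exponential growth in the second variable, locally bounded in the first. -/
def EG {V : Type} [NormedAddCommGroup V] (h : P × Z → V) : Prop :=
  ∀ R : ℝ, ∃ K : ℝ, 0 ≤ K ∧ ∀ q : P × Z, ‖q.1‖ ≤ R → ‖h q‖ ≤ exp (K * (1 + ‖q.2‖))

/-- `CG N h`: `h` is `N` times differentiable with continuous derivatives of exponential growth. -/
def CG : ℕ → {V : Type} → [NormedAddCommGroup V] → [NormedSpace ℝ V] → (P × Z → V) → Prop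
  | 0, _, _, _, h => Continuous h ∧ EG h
  | N+1, _, _, _, h => (Continuous h ∧ EG h) ∧ Differentiable ℝ h ∧ CG N (fderiv ℝ h)

variable [NormedAddCommGroup V] [NormedSpace ℝ V] [NormedAddCommGroup W] [NormedSpace ℝ W]

theorem CG.cont {N : ℕ} {h : P × Z → V} (H : CG N h) : Continuous h := by
  cases N with
  | zero => exact H.1
  | succ N => exact H.1.1

theorem CG.eg {N : ℕ} {h : P × Z → V} (H : CG N h) : EG h := by
  cases N with
  | zero => exact H.2
  | succ N => exact H.1.2

theorem CG.zero {N : ℕ} {h : P × Z → V} (H : CG N h) : CG 0 h := ⟨H.cont, H.eg⟩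

theorem CG.pred {N : ℕ} : ∀ {V : Type} [NormedAddCommGroup V] [NormedSpace ℝ V] {h : P × Z → V},
    CG (N+1) h → CG N h := by
  induction N with
  | zero => intro V _ _ h H; exact H.zero
  | succ N ih => intro V _ _ h H; exact ⟨H.1, H.2.1, ih H.2.2⟩

theorem EG.mono_exp {K K' a : ℝ} (h : K ≤ K') (ha : 0 ≤ a) : exp (K * (1 + a)) ≤ exp (K' * (1 + a)) := by
  apply Real.exp_le_exp.2; nlinarith

theorem EG.add {f g : P × Z → V} (hf : EG f) (hg : EG g) : EG (fun q => f q + g q) := by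
  intro R
  obtain ⟨K, hK, h1⟩ := hf R
  obtain ⟨K', hK', h2⟩ := hg R
  refine ⟨K + K' + 1, by positivity, fun q hq => ?_⟩
  have e1 := (h1 q hq).trans (EG.mono_exp (show K ≤ K + K' by linarith) (norm_nonneg q.2))
  have e2 := (h2 q hq).trans (EG.mono_exp (show K' ≤ K + K' by linarith) (norm_nonneg q.2))
  have e3 : exp ((K + K' + 1) * (1 + ‖q.2‖)) = exp ((K + K') * (1 + ‖q.2‖)) * exp (1 + ‖q.2‖) := by
    rw [← Real.exp_add]; ring_nf
  have e4 : (2:ℝ) ≤ exp (1 + ‖q.2‖) := by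
    have := Real.add_one_le_exp (1 + ‖q.2‖)
    have := norm_nonneg q.2
    linarith
  rw [e3]
  have := norm_add_le (f q) (g q)
  nlinarith [Real.exp_pos ((K + K') * (1 + ‖q.2‖))]

theorem EG.of_le_mul {U₁ U₂ : Type} [NormedAddCommGroup U₁] [NormedAddCommGroup U₂]
    {f : P × Z → U₁} {g : P × Z → U₂} {h : P × Z → V} (C : ℝ) (hf : EG f) (hg : EG g)
    (H : ∀ q, ‖h q‖ ≤ C * (‖f q‖ * ‖g q‖)) : EG h := by
  intro R
  obtain ⟨K, hK, h1⟩ := hf R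
  obtain ⟨K', hK', h2⟩ := hg R
  refine ⟨K + K' + |C|, by positivity, fun q hq => ?_⟩
  have hz := norm_nonneg q.2
  have e1 := h1 q hq
  have e2 := h2 q hq
  have e3 : exp ((K + K' + |C|) * (1 + ‖q.2‖)) =
      exp (|C| * (1 + ‖q.2‖)) * (exp (K * (1 + ‖q.2‖)) * exp (K' * (1 + ‖q.2‖))) := by
    rw [← Real.exp_add, ← Real.exp_add]; ring_nf
  have e4 : C ≤ exp (|C| * (1 + ‖q.2‖)) := by
    have := Real.add_one_le_exp (|C| * (1 + ‖q.2‖))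
    have h5 := le_abs_self C
    have h6 := abs_nonneg C
    nlinarith
  rw [e3]
  refine (H q).trans ?_
  gcongr

theorem EG.mono {f : P × Z → V} {g : P × Z → W} (hf : EG f) (H : ∀ q, ‖g q‖ ≤ ‖f q‖) : EG g := by
  intro R
  obtain ⟨K, hK, h1⟩ := hf R
  exact ⟨K, hK, fun q hq => (H q).trans (h1 q hq)⟩

theorem EG.const (v : V) : EG (fun _ : P × Z => v) := by
  intro R
  refine ⟨‖v‖, norm_nonneg _, fun q _ => ?_⟩
  have := Real.add_one_le_exp (‖v‖ * (1 + ‖q.2‖))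
  have h1 := norm_nonneg v
  have h2 := norm_nonneg q.2
  nlinarith

theorem EG.clm (A : P × Z →L[ℝ] V) : EG (fun q => A q) := by
  intro R
  refine ⟨‖A‖ * (1 + |R|), by positivity, fun q hq => ?_⟩
  have h1 := norm_nonneg q.2
  have h4 : ‖q‖ ≤ (1 + |R|) * (1 + ‖q.2‖) := by
    have h3 := le_abs_self R
    have h5 := abs_nonneg R
    rw [Prod.norm_def]
    apply max_le <;> nlinarith
  have h2 := A.le_opNorm q
  have h6 : ‖A q‖ ≤ ‖A‖ * (1 + |R|) * (1 + ‖q.2‖) := by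
    refine h2.trans ?_
    rw [mul_assoc]
    gcongr
  have := Real.add_one_le_exp (‖A‖ * (1 + |R|) * (1 + ‖q.2‖))
  linarith

theorem CG.const (N : ℕ) : ∀ {V : Type} [NormedAddCommGroup V] [NormedSpace ℝ V] (v : V),
    CG N (fun _ : P × Z => v) := by
  induction N with
  | zero => intro V _ _ v; exact ⟨continuous_const, EG.const v⟩
  | succ N ih =>
    intro V _ _ v
    refine ⟨⟨continuous_const, EG.const v⟩, differentiable_const v, ?_⟩
    have : fderiv ℝ (fun _ : P × Z => v) = fun _ => 0 := by
      ext1 q; simp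
    rw [this]
    exact ih 0

theorem CG.clm (N : ℕ) (A : P × Z →L[ℝ] V) : CG N (fun q => A q) := by
  cases N with
  | zero => exact ⟨A.continuous, EG.clm A⟩
  | succ N =>
    refine ⟨⟨A.continuous, EG.clm A⟩, A.differentiable, ?_⟩
    have : fderiv ℝ (fun q => A q) = fun _ => A := by
      ext1 q; exact A.fderiv
    rw [this]
    exact CG.const N A

theorem CG.add {N : ℕ} : ∀ {V : Type} [NormedAddCommGroup V] [NormedSpace ℝ V] {f g : P × Z → V},
    CG N f → CG N g → CG N (fun q => f q + g q) := by
  induction N with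
  | zero => intro V _ _ f g hf hg; exact ⟨hf.cont.add hg.cont, hf.eg.add hg.eg⟩
  | succ N ih =>
    intro V _ _ f g hf hg
    refine ⟨⟨hf.cont.add hg.cont, hf.eg.add hg.eg⟩, hf.2.1.add hg.2.1, ?_⟩
    have : fderiv ℝ (fun q => f q + g q) = fun q => fderiv ℝ f q + fderiv ℝ g q := by
      ext1 q; exact fderiv_fun_add (hf.2.1 q) (hg.2.1 q)
    rw [this]
    exact ih hf.2.2 hg.2.2

theorem CG.clm_comp {N : ℕ} : ∀ {V W : Type} [NormedAddCommGroup V] [NormedSpace ℝ V]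
    [NormedAddCommGroup W] [NormedSpace ℝ W] {f : P × Z → V} (A : V →L[ℝ] W),
    CG N f → CG N (fun q => A (f q)) := by
  have key : ∀ {V W : Type} [NormedAddCommGroup V] [NormedSpace ℝ V]
    [NormedAddCommGroup W] [NormedSpace ℝ W] {f : P × Z → V} (A : V →L[ℝ] W),
    EG f → EG (fun q => A (f q)) := by
    intro V W _ _ _ _ f A hf
    refine EG.of_le_mul ‖A‖ hf (EG.const (1:ℝ)) (fun q => ?_)
    simpa using A.le_opNorm (f q)
  induction N with
  | zero =>
    intro V W _ _ _ _ f A hf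
    exact ⟨A.continuous.comp hf.cont, key A hf.eg⟩
  | succ N ih =>
    intro V W _ _ _ _ f A hf
    refine ⟨⟨A.continuous.comp hf.cont, key A hf.eg⟩, A.differentiable.comp hf.2.1, ?_⟩
    have : fderiv ℝ (fun q => A (f q)) =
        fun q => (ContinuousLinearMap.compL ℝ (P × Z) V W A) (fderiv ℝ f q) := by
      ext1 q
      exact (A.hasFDerivAt.comp q (hf.2.1 q).hasFDerivAt).fderiv
    rw [this]
    exact ih _ hf.2.2

theorem CG.bilin {N : ℕ} : ∀ {V₁ V₂ W : Type} [NormedAddCommGroup V₁] [NormedSpace ℝ V₁]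
    [NormedAddCommGroup V₂] [NormedSpace ℝ V₂]
    [NormedAddCommGroup W] [NormedSpace ℝ W] {f : P × Z → V₁} {g : P × Z → V₂}
    (B : V₁ →L[ℝ] V₂ →L[ℝ] W), CG N f → CG N g → CG N (fun q => B (f q) (g q)) := by
  have key : ∀ {V₁ V₂ W : Type} [NormedAddCommGroup V₁] [NormedSpace ℝ V₁]
    [NormedAddCommGroup V₂] [NormedSpace ℝ V₂]
    [NormedAddCommGroup W] [NormedSpace ℝ W] {f : P × Z → V₁} {g : P × Z → V₂}
    (B : V₁ →L[ℝ] V₂ →L[ℝ] W), EG f → EG g → EG (fun q => B (f q) (g q)) := by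
    intro V₁ V₂ W _ _ _ _ _ _ f g B hf hg
    refine EG.of_le_mul ‖B‖ hf hg (fun q => ?_)
    rw [← mul_assoc]
    exact B.le_opNorm₂ _ _
  have keyc : ∀ {V₁ V₂ W : Type} [NormedAddCommGroup V₁] [NormedSpace ℝ V₁]
    [NormedAddCommGroup V₂] [NormedSpace ℝ V₂]
    [NormedAddCommGroup W] [NormedSpace ℝ W] {f : P × Z → V₁} {g : P × Z → V₂}
    (B : V₁ →L[ℝ] V₂ →L[ℝ] W), Continuous f → Continuous g →
      Continuous (fun q => B (f q) (g q)) := by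
    intro V₁ V₂ W _ _ _ _ _ _ f g B hf hg
    exact B.continuous₂.comp (hf.prodMk hg)
  induction N with
  | zero =>
    intro V₁ V₂ W _ _ _ _ _ _ f g B hf hg
    exact ⟨keyc B hf.cont hg.cont, key B hf.eg hg.eg⟩
  | succ N ih =>
    intro V₁ V₂ W _ _ _ _ _ _ f g B hf hg
    refine ⟨⟨keyc B hf.cont hg.cont, key B hf.eg hg.eg⟩, ?_, ?_⟩
    · intro q
      exact (B.hasFDerivAt_of_bilinear (hf.2.1 q).hasFDerivAt (hg.2.1 q).hasFDerivAt).differentiableAt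
    have : fderiv ℝ (fun q => B (f q) (g q)) =
        fun q => (ContinuousLinearMap.precompR (P × Z) B) (f q) (fderiv ℝ g q) +
          (ContinuousLinearMap.precompL (P × Z) B) (fderiv ℝ f q) (g q) := by
      ext1 q
      exact B.fderiv_of_bilinear (hf.2.1 q) (hg.2.1 q)
    rw [this]
    exact (ih _ hf.pred hg.2.2).add (ih _ hf.2.2 hg.pred)

theorem CG.mul {N : ℕ} {f g : P × Z → ℝ} (hf : CG N f) (hg : CG N g) :
    CG N (fun q => f q * g q) :=
  CG.bilin (ContinuousLinearMap.mul ℝ ℝ) hf hg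

theorem CG.smul {N : ℕ} {f : P × Z → ℝ} {g : P × Z → V} (hf : CG N f) (hg : CG N g) :
    CG N (fun q => f q • g q) :=
  CG.bilin (ContinuousLinearMap.lsmul ℝ ℝ) hf hg

theorem CG.const_mul {N : ℕ} {f : P × Z → ℝ} (c : ℝ) (hf : CG N f) :
    CG N (fun q => c * f q) := (CG.const N c).mul hf

theorem CG.sum {N : ℕ} {ι : Type} (S : Finset ι) {f : ι → P × Z → V} (hf : ∀ i ∈ S, CG N (f i)) :
    CG N (fun q => ∑ i ∈ S, f i q) := by
  classical
  induction S using Finset.induction_on with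
  | empty => simpa using CG.const N (0:V)
  | insert a S ha ih =>
    have : (fun q => ∑ i ∈ insert a S, f i q) = fun q => f a q + ∑ i ∈ S, f i q := by
      ext q; rw [Finset.sum_insert ha]
    rw [this]
    exact (hf a (Finset.mem_insert_self _ _)).add
      (ih fun i hi => hf i (Finset.mem_insert_of_mem hi))

/-- Composition with a map of at most linear growth. -/
theorem CG.comp {N : ℕ} {T : P × Z' → P × Z} (hT : CG N T)
    (hT1 : ∀ R, ∃ R' K : ℝ, 0 ≤ K ∧ ∀ q, ‖q.1‖ ≤ R → ‖(T q).1‖ ≤ R' ∧ ‖(T q).2‖ ≤ K * (1 + ‖q.2‖)) :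
    ∀ {V : Type} [NormedAddCommGroup V] [NormedSpace ℝ V] {f : P × Z → V},
    CG N f → CG N (fun q => f (T q)) := by
  have key : ∀ {V : Type} [NormedAddCommGroup V] [NormedSpace ℝ V] {f : P × Z → V},
      EG f → EG (fun q => f (T q)) := by
    intro V _ _ f hf R
    obtain ⟨R', K, hK, h1⟩ := hT1 R
    obtain ⟨K', hK', h2⟩ := hf R'
    refine ⟨K' * (1 + K), by positivity, fun q hq => ?_⟩
    refine (h2 (T q) (h1 q hq).1).trans (Real.exp_le_exp.2 ?_)
    have h3 := (h1 q hq).2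
    have h4 := norm_nonneg q.2
    rw [mul_assoc]
    apply mul_le_mul_of_nonneg_left _ hK'
    nlinarith
  induction N with
  | zero =>
    intro V _ _ f hf
    exact ⟨hf.cont.comp hT.cont, key hf.eg⟩
  | succ N ih =>
    intro V _ _ f hf
    refine ⟨⟨hf.cont.comp hT.cont, key hf.eg⟩, hf.2.1.comp hT.2.1, ?_⟩
    have : fderiv ℝ (fun q => f (T q)) =
        fun q => (ContinuousLinearMap.compL ℝ (P × Z') (P × Z) V) (fderiv ℝ f (T q)) (fderiv ℝ T q) := by
      ext1 q
      exact ((hf.2.1 (T q)).hasFDerivAt.comp q (hT.2.1 q).hasFDerivAt).fderiv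
    rw [this]
    exact CG.bilin _ (ih hT.pred hf.2.2) hT.2.2

/-- directional derivative -/
def dd (v : P × Z) (f : P × Z → ℝ) : P × Z → ℝ := fun q => fderiv ℝ f q v

theorem CG.dd {N : ℕ} {f : P × Z → ℝ} (v : P × Z) (hf : CG (N+1) f) : CG N (dd v f) :=
  CG.clm_comp (ContinuousLinearMap.apply ℝ ℝ v) hf.2.2

/-- `T`-type of exponent functions : exponential of linear functional in `Z`. -/
theorem CG.exp_clm (N : ℕ) (A : Z →L[ℝ] ℝ) : CG N (fun q : P × Z => exp (A q.2)) := by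
  have key : EG (fun q : P × Z => exp (A q.2)) := by
    intro R
    refine ⟨‖A‖, norm_nonneg _, fun q _ => ?_⟩
    rw [Real.norm_eq_abs, abs_of_pos (Real.exp_pos _)]
    apply Real.exp_le_exp.2
    have := A.le_opNorm q.2
    have h1 := le_abs_self (A q.2)
    rw [Real.norm_eq_abs] at this
    have := norm_nonneg A
    nlinarith
  have hd : ∀ q : P × Z, HasFDerivAt (fun q : P × Z => exp (A q.2))
      (exp (A q.2) • (A.comp (ContinuousLinearMap.snd ℝ P Z))) q := by
    intro q
    exact (A.hasFDerivAt.comp q hasFDerivAt_snd).exp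
  induction N with
  | zero => exact ⟨by fun_prop, key⟩
  | succ N ih =>
    refine ⟨⟨by fun_prop, key⟩, fun q => (hd q).differentiableAt, ?_⟩
    have : fderiv ℝ (fun q : P × Z => exp (A q.2)) =
      fun q => exp (A q.2) • (A.comp (ContinuousLinearMap.snd ℝ P Z)) := by
      ext1 q; exact (hd q).fderiv
    rw [this]
    exact ih.smul (CG.const N _)

/-- positive functions with inverse of exponential growth -/
structure PG (N : ℕ) (f : P × Z → ℝ) : Prop where
  pos : ∀ q, 0 < f q
  cg : CG N f
  inv : EG (fun q => (f q)⁻¹)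

theorem PG.eg_rpow {N : ℕ} {f : P × Z → ℝ} (hf : PG N f) (a : ℝ) : EG (fun q => f q ^ a) := by
  intro R
  obtain ⟨K, hK, h1⟩ := hf.cg.eg R
  obtain ⟨K', hK', h2⟩ := hf.inv R
  refine ⟨|a| * (K + K'), by positivity, fun q hq => ?_⟩
  have hp := hf.pos q
  have e1 := h1 q hq
  have e2 := h2 q hq
  rw [Real.norm_eq_abs, abs_of_pos hp, ← Real.log_le_iff_le_exp hp] at e1
  rw [Real.norm_eq_abs, abs_of_pos (inv_pos.2 hp), ← Real.log_le_iff_le_exp (inv_pos.2 hp),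
    Real.log_inv] at e2
  rw [Real.norm_eq_abs, abs_of_pos (Real.rpow_pos_of_pos hp a), Real.rpow_def_of_pos hp]
  apply Real.exp_le_exp.2
  have hz := norm_nonneg q.2
  have h3 : |Real.log (f q)| ≤ (K + K') * (1 + ‖q.2‖) := by
    rw [abs_le]; constructor <;> nlinarith
  calc Real.log (f q) * a ≤ |Real.log (f q) * a| := le_abs_self _
    _ = |a| * |Real.log (f q)| := by rw [abs_mul, mul_comm]
    _ ≤ |a| * ((K + K') * (1 + ‖q.2‖)) := by gcongr
    _ = _ := by ring

theorem PG.rpow {N : ℕ} {f : P × Z → ℝ} (hf : PG N f) (a : ℝ) : CG N (fun q => f q ^ a) := by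
  induction N generalizing a with
  | zero =>
    exact ⟨hf.cg.cont.rpow_const fun q => Or.inl (hf.pos q).ne', hf.eg_rpow a⟩
  | succ N ih =>
    have hd : ∀ q, HasFDerivAt (fun q => f q ^ a) ((a * f q ^ (a - 1)) • fderiv ℝ f q) q :=
      fun q => (hf.cg.2.1 q).hasFDerivAt.rpow_const (Or.inl (hf.pos q).ne')
    refine ⟨⟨hf.cg.cont.rpow_const fun q => Or.inl (hf.pos q).ne', hf.eg_rpow a⟩,
      fun q => (hd q).differentiableAt, ?_⟩
    have : fderiv ℝ (fun q => f q ^ a) = fun q => (a * f q ^ (a - 1)) • fderiv ℝ f q := by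
      ext1 q; exact (hd q).fderiv
    rw [this]
    exact ((ih ⟨hf.pos, hf.cg.pred, hf.inv⟩ (a-1)).const_mul a).smul hf.cg.2.2

theorem PG.inv' {N : ℕ} {f : P × Z → ℝ} (hf : PG N f) : CG N (fun q => (f q)⁻¹) := by
  have := hf.rpow (-1)
  simpa only [Real.rpow_neg_one] using this

theorem PG.rpow' {N : ℕ} {f : P × Z → ℝ} (hf : PG N f) (a : ℝ) : PG N (fun q => f q ^ a) := by
  refine ⟨fun q => Real.rpow_pos_of_pos (hf.pos q) a, hf.rpow a, ?_⟩
  have := hf.eg_rpow (-a)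
  refine this.mono fun q => ?_
  rw [Real.rpow_neg (hf.pos q).le]

theorem PG.log {N : ℕ} {f : P × Z → ℝ} (hf : PG N f) : CG N (fun q => Real.log (f q)) := by
  have key : EG (fun q => Real.log (f q)) := by
    refine (hf.cg.eg.add hf.inv).mono fun q => ?_
    have hp := hf.pos q
    have hp' := inv_pos.2 hp
    rw [Real.norm_eq_abs, Real.norm_eq_abs, abs_of_pos (add_pos hp hp'), abs_le]
    have h1 := Real.log_le_sub_one_of_pos hp
    have h2 := Real.log_le_sub_one_of_pos hp'
    rw [Real.log_inv] at h2
    constructor <;> linarith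
  have hc : Continuous (fun q => Real.log (f q)) :=
    hf.cg.cont.log fun q => (hf.pos q).ne'
  cases N with
  | zero => exact ⟨hc, key⟩
  | succ N =>
    have hd : ∀ q, HasFDerivAt (fun q => Real.log (f q)) ((f q)⁻¹ • fderiv ℝ f q) q :=
      fun q => (hf.cg.2.1 q).hasFDerivAt.log (hf.pos q).ne'
    refine ⟨⟨hc, key⟩, fun q => (hd q).differentiableAt, ?_⟩
    have : fderiv ℝ (fun q => Real.log (f q)) = fun q => (f q)⁻¹ • fderiv ℝ f q := by
      ext1 q; exact (hd q).fderiv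
    rw [this]
    exact hf.inv'.pred.smul hf.cg.2.2

theorem PG.sum {N : ℕ} {ι : Type} [Fintype ι] [Nonempty ι] {f : ι → P × Z → ℝ}
    (hf : ∀ i, PG N (f i)) : PG N (fun q => ∑ i, f i q) := by
  have hpos : ∀ q, 0 < ∑ i, f i q := fun q =>
    Finset.sum_pos (fun i _ => (hf i).pos q) Finset.univ_nonempty
  refine ⟨hpos, CG.sum _ fun i _ => (hf i).cg, ?_⟩
  obtain ⟨i⟩ := ‹Nonempty ι›
  refine (hf i).inv.mono fun q => ?_
  rw [Real.norm_eq_abs, Real.norm_eq_abs, abs_of_pos (inv_pos.2 (hpos q)),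
    abs_of_pos (inv_pos.2 ((hf i).pos q))]
  apply inv_anti₀ ((hf i).pos q)
  exact Finset.single_le_sum (f := fun i => f i q) (fun j _ => ((hf j).pos q).le) (Finset.mem_univ i)

end growth

end part1

section part2
section avg

variable {P Z X Y V : Type}
  [NormedAddCommGroup P] [NormedSpace ℝ P]
  [NormedAddCommGroup Z] [NormedSpace ℝ Z]
  [NormedAddCommGroup X] [NormedSpace ℝ X] [MeasurableSpace X] [BorelSpace X]
  [SecondCountableTopology X]
  [NormedAddCommGroup Y] [NormedSpace ℝ Y] [MeasurableSpace Y] [BorelSpace Y]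
  [SecondCountableTopology Y]
  [NormedAddCommGroup V] [NormedSpace ℝ V]

/-- All exponential moments of the norm are finite. -/
def ExpMom (μ : Measure X) : Prop := ∀ K : ℝ, Integrable (fun u => exp (K * ‖u‖)) μ

theorem ExpMom.prod {μ : Measure X} {ν : Measure Y} [IsProbabilityMeasure μ]
    [IsProbabilityMeasure ν] (hμ : ExpMom μ) (hν : ExpMom ν) : ExpMom (μ.prod ν) := by
  intro K
  have h := (hμ |K|).mul_prod (hν |K|)
  refine h.mono' (Continuous.aestronglyMeasurable (by fun_prop)) (Filter.Eventually.of_forall ?_)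
  intro w
  rw [Real.norm_eq_abs, abs_of_pos (Real.exp_pos _), ← Real.exp_add]
  apply Real.exp_le_exp.2
  have h1 : ‖w‖ ≤ ‖w.1‖ + ‖w.2‖ := by
    rw [Prod.norm_def]
    apply max_le <;> linarith [norm_nonneg w.1, norm_nonneg w.2]
  calc K * ‖w‖ ≤ |K| * ‖w‖ := by gcongr; exact le_abs_self K
    _ ≤ |K| * (‖w.1‖ + ‖w.2‖) := by gcongr
    _ = _ := by ring

theorem ExpMom.pi {d : ℕ} {μ : Measure X} [IsProbabilityMeasure μ] (hμ : ExpMom μ) :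
    ExpMom (Measure.pi fun _ : Fin d => μ) := by
  intro K
  have h := Integrable.fintype_prod (ι := Fin d) (f := fun _ u => exp (|K| * ‖u‖))
    (μ := fun _ => μ) (fun _ => hμ |K|)
  refine h.mono' (Continuous.aestronglyMeasurable (by fun_prop)) (Filter.Eventually.of_forall ?_)
  intro w
  rw [Real.norm_eq_abs, abs_of_pos (Real.exp_pos _), ← Real.exp_sum]
  apply Real.exp_le_exp.2
  rw [← Finset.mul_sum]
  have h1 : ‖w‖ ≤ ∑ i, ‖w i‖ := by
    rw [pi_norm_le_iff_of_nonneg (by positivity)]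
    intro i
    exact Finset.single_le_sum (f := fun i => ‖w i‖) (fun j _ => norm_nonneg _) (Finset.mem_univ i)
  calc K * ‖w‖ ≤ |K| * ‖w‖ := by gcongr; exact le_abs_self K
    _ ≤ _ := by gcongr

theorem ExpMom.integrable {μ : Measure X} (hμ : ExpMom μ) {h : X → V} (hc : Continuous h)
    (C K : ℝ) (hb : ∀ u, ‖h u‖ ≤ C * exp (K * ‖u‖)) : Integrable h μ :=
  ((hμ K).const_mul C).mono' hc.aestronglyMeasurable (Filter.Eventually.of_forall hb)

variable (μ : Measure X) [IsProbabilityMeasure μ]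

theorem exp_split {K : ℝ} (hK : 0 ≤ K) {a : ℝ} (z : Z) (u : X) (hz : ‖z‖ ≤ a) :
    exp (K * (1 + ‖(z, u)‖)) ≤ exp (K * (1 + a)) * exp (K * ‖u‖) := by
  rw [← Real.exp_add]
  apply Real.exp_le_exp.2
  have h1 : ‖(z, u)‖ ≤ a + ‖u‖ := by
    rw [Prod.norm_def]
    have := norm_nonneg z
    have := norm_nonneg u
    apply max_le <;> simp only <;> linarith
  nlinarith

theorem EG.integrable (hμ : ExpMom μ) {k : P × (Z × X) → V} (hc : Continuous k) (hk : EG k) (q : P × Z) :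
    Integrable (fun u => k (q.1, (q.2, u))) μ := by
  obtain ⟨K, hK, h⟩ := hk ‖q.1‖
  exact hμ.integrable (by fun_prop) _ K
    (fun u => (h (q.1, (q.2, u)) le_rfl).trans (exp_split hK q.2 u le_rfl))

/-- The canonical inclusion. -/
def iotaL : P × Z →L[ℝ] P × (Z × X) :=
  (ContinuousLinearMap.fst ℝ P Z).prod
    ((ContinuousLinearMap.snd ℝ P Z).prod 0)

theorem CG.integral_zero (hμ : ExpMom μ) {k : P × (Z × X) → V} (hk : CG 0 k) :
    CG 0 (fun q : P × Z => ∫ u, k (q.1, (q.2, u)) ∂μ) := by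
  have hc := hk.cont
  refine ⟨?_, ?_⟩
  · rw [continuous_iff_continuousAt]
    intro q₀
    obtain ⟨K, hK, h⟩ := hk.eg (‖q₀.1‖ + 1)
    have hev : ∀ᶠ q in nhds q₀, ‖q.1‖ < ‖q₀.1‖ + 1 ∧ ‖q.2‖ < ‖q₀.2‖ + 1 := by
      have h1 : ContinuousAt (fun q : P × Z => ‖q.1‖) q₀ := by fun_prop
      have h2 : ContinuousAt (fun q : P × Z => ‖q.2‖) q₀ := by fun_prop
      exact (h1.eventually_lt_const (by linarith)).and (h2.eventually_lt_const (by linarith))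
    refine continuousAt_of_dominated
      (bound := fun u => exp (K * (1 + (‖q₀.2‖ + 1))) * exp (K * ‖u‖)) ?_ ?_ ?_ ?_
    · refine Filter.Eventually.of_forall fun q => Continuous.aestronglyMeasurable (by fun_prop)
    · filter_upwards [hev] with q hq
      refine Filter.Eventually.of_forall fun u => ?_
      exact (h (q.1, (q.2, u)) hq.1.le).trans (exp_split hK q.2 u hq.2.le)
    · exact (hμ K).const_mul _
    · refine Filter.Eventually.of_forall fun u => ?_
      have : Continuous fun q : P × Z => k (q.1, (q.2, u)) := by fun_prop
      exact this.continuousAt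
  · intro R
    obtain ⟨K, hK, h⟩ := hk.eg R
    set M := ∫ u, exp (K * ‖u‖) ∂μ with hM
    have hM0 : 0 ≤ M := integral_nonneg fun u => (Real.exp_pos _).le
    refine ⟨K + M, by positivity, fun q hq => ?_⟩
    have h1 : ‖∫ u, k (q.1, (q.2, u)) ∂μ‖ ≤ ∫ u, exp (K * (1 + ‖q.2‖)) * exp (K * ‖u‖) ∂μ := by
      apply norm_integral_le_of_norm_le ((hμ K).const_mul _)
      refine Filter.Eventually.of_forall fun u => ?_
      exact (h (q.1, (q.2, u)) hq).trans (exp_split hK q.2 u le_rfl)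
    rw [integral_const_mul, ← hM] at h1
    refine h1.trans ?_
    rw [add_mul, Real.exp_add]
    gcongr
    have h2 := Real.add_one_le_exp (M * (1 + ‖q.2‖))
    have h3 := norm_nonneg q.2
    nlinarith

theorem hasFDerivAt_avg (hμ : ExpMom μ) {k : P × (Z × X) → V} (hk : CG 1 k) (q₀ : P × Z) :
    HasFDerivAt (fun q : P × Z => ∫ u, k (q.1, (q.2, u)) ∂μ)
      (∫ u, (fderiv ℝ k (q₀.1, (q₀.2, u))).comp iotaL ∂μ) q₀ := by
  have hc := hk.cont
  have hc' := hk.2.2.cont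
  have hk' : CG 0 (fun w => (fderiv ℝ k w).comp (iotaL (P := P) (Z := Z) (X := X))) :=
    CG.clm_comp ((ContinuousLinearMap.compL ℝ (P × Z) (P × (Z × X)) V).flip iotaL) hk.2.2
  obtain ⟨K, hK, h⟩ := hk'.eg (‖q₀.1‖ + 1)
  have hev : ∀ᶠ q in nhds q₀, ‖q.1‖ < ‖q₀.1‖ + 1 ∧ ‖q.2‖ < ‖q₀.2‖ + 1 := by
    have h1 : ContinuousAt (fun q : P × Z => ‖q.1‖) q₀ := by fun_prop
    have h2 : ContinuousAt (fun q : P × Z => ‖q.2‖) q₀ := by fun_prop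
    exact (h1.eventually_lt_const (by linarith)).and (h2.eventually_lt_const (by linarith))
  refine hasFDerivAt_integral_of_dominated_of_fderiv_le
    (F := fun (q : P × Z) u => k (q.1, (q.2, u)))
    (F' := fun q u => (fderiv ℝ k (q.1, (q.2, u))).comp iotaL)
    (bound := fun u => exp (K * (1 + (‖q₀.2‖ + 1))) * exp (K * ‖u‖)) hev ?_ ?_ ?_ ?_ ?_ ?_
  · refine Filter.Eventually.of_forall fun q => Continuous.aestronglyMeasurable (by fun_prop)
  · exact EG.integrable μ hμ hc hk.eg q₀
  · have := hk'.cont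
    exact Continuous.aestronglyMeasurable
      (this.comp (by fun_prop : Continuous fun u : X => (q₀.1, (q₀.2, u))))
  · refine Filter.Eventually.of_forall fun u q hq => ?_
    exact (h (q.1, (q.2, u)) hq.1.le).trans (exp_split hK q.2 u hq.2.le)
  · exact (hμ K).const_mul _
  · refine Filter.Eventually.of_forall fun u q hq => ?_
    have e : HasFDerivAt (fun q : P × Z => (q.1, (q.2, u))) (iotaL (P := P) (Z := Z) (X := X)) q :=
      hasFDerivAt_fst.prodMk (hasFDerivAt_snd.prodMk (hasFDerivAt_const u q))
    exact (hk.2.1 (q.1, (q.2, u))).hasFDerivAt.comp q e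

theorem CG.integral (hμ : ExpMom μ) {N : ℕ} : ∀ {V : Type} [NormedAddCommGroup V] [NormedSpace ℝ V]
    {k : P × (Z × X) → V}, CG N k → CG N (fun q : P × Z => ∫ u, k (q.1, (q.2, u)) ∂μ) := by
  induction N with
  | zero => intro V _ _ k hk; exact CG.integral_zero μ hμ hk
  | succ N ih =>
    intro V _ _ k hk
    have hk1 : CG 1 k := ⟨hk.1, hk.2.1, hk.2.2.zero⟩
    refine ⟨CG.integral_zero μ hμ hk.zero,
      fun q => (hasFDerivAt_avg μ hμ hk1 q).differentiableAt, ?_⟩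
    have : fderiv ℝ (fun q : P × Z => ∫ u, k (q.1, (q.2, u)) ∂μ) =
        fun q => ∫ u, (fderiv ℝ k (q.1, (q.2, u))).comp iotaL ∂μ := by
      ext1 q; exact (hasFDerivAt_avg μ hμ hk1 q).fderiv
    rw [this]
    exact ih (CG.clm_comp ((ContinuousLinearMap.compL ℝ (P × Z) (P × (Z × X)) V).flip iotaL) hk.2.2)

theorem PG.integral (hμ : ExpMom μ) {N : ℕ} {k : P × (Z × X) → ℝ} (hk : PG N k) :
    PG N (fun q : P × Z => ∫ u, k (q.1, (q.2, u)) ∂μ) := by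
  have hlow : ∀ R, ∃ K : ℝ, 0 ≤ K ∧ ∀ q : P × Z, ‖q.1‖ ≤ R →
      exp (-(K * (1 + ‖q.2‖))) * (∫ u, exp (-K * ‖u‖) ∂μ) ≤ ∫ u, k (q.1, (q.2, u)) ∂μ := by
    intro R
    obtain ⟨K, hK, h⟩ := hk.inv R
    refine ⟨K, hK, fun q hq => ?_⟩
    rw [← integral_const_mul]
    apply integral_mono ((hμ (-K)).const_mul _) (EG.integrable μ hμ hk.cg.cont hk.cg.eg q)
    intro u
    have hp := hk.pos (q.1, (q.2, u))
    have h1 := (h (q.1, (q.2, u)) hq).trans (exp_split hK q.2 u le_rfl)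
    rw [Real.norm_eq_abs, abs_of_pos (inv_pos.2 hp), ← Real.exp_add] at h1
    have h2 := inv_anti₀ (inv_pos.2 hp) h1
    rw [inv_inv, ← Real.exp_neg] at h2
    refine le_trans (le_of_eq ?_) h2
    simp only
    rw [← Real.exp_add]
    ring_nf
  have hMpos : ∀ K, 0 < ∫ u, exp (-K * ‖u‖) ∂μ := by
    intro K
    rw [integral_pos_iff_support_of_nonneg (fun u => (Real.exp_pos _).le) (hμ (-K))]
    have : Function.support (fun u : X => exp (-K * ‖u‖)) = Set.univ := by
      ext u; simp [(Real.exp_pos _).ne']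
    rw [this]; simp
  have hpos : ∀ q : P × Z, 0 < ∫ u, k (q.1, (q.2, u)) ∂μ := by
    intro q
    obtain ⟨K, _, h⟩ := hlow ‖q.1‖
    exact lt_of_lt_of_le (mul_pos (Real.exp_pos _) (hMpos K)) (h q le_rfl)
  refine ⟨hpos, CG.integral μ hμ hk.cg, ?_⟩
  intro R
  obtain ⟨K, hK, h⟩ := hlow R
  set M := ∫ u, exp (-K * ‖u‖) ∂μ
  have hM := hMpos K
  refine ⟨K + M⁻¹, by positivity, fun q hq => ?_⟩
  rw [Real.norm_eq_abs, abs_of_pos (inv_pos.2 (hpos q))]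
  have h1 := inv_anti₀ (mul_pos (Real.exp_pos _) hM) (h q hq)
  refine h1.trans ?_
  rw [mul_inv, ← Real.exp_neg, neg_neg, add_mul, Real.exp_add]
  gcongr
  have h2 := Real.add_one_le_exp (M⁻¹ * (1 + ‖q.2‖))
  have h3 := norm_nonneg q.2
  have h4 := inv_pos.2 hM
  change M⁻¹ ≤ _
  nlinarith

end avg

/-! ### Gaussian integration by parts -/
section stein

variable {X Y : Type}
  [NormedAddCommGroup X] [NormedSpace ℝ X] [MeasurableSpace X] [BorelSpace X]
  [SecondCountableTopology X]
  [NormedAddCommGroup Y] [NormedSpace ℝ Y] [MeasurableSpace Y] [BorelSpace Y]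
  [SecondCountableTopology Y]

/-- Gaussian integration by parts for the coordinate `ξ` and direction `e`. -/
def Stein (μ : Measure X) (ξ : X →L[ℝ] ℝ) (e : X) : Prop :=
  ∀ (h : X → ℝ) (h' : X → X →L[ℝ] ℝ), (∀ u, HasFDerivAt h (h' u) u) → Continuous h' →
    (∃ K, 0 ≤ K ∧ ∀ u, ‖h u‖ ≤ exp (K * (1 + ‖u‖))) →
    (∃ K, 0 ≤ K ∧ ∀ u, ‖h' u‖ ≤ exp (K * (1 + ‖u‖))) →
    ∫ u, ξ u * h u ∂μ = ∫ u, h' u e ∂μ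

theorem int_of_bd {μ : Measure X} (hμ : ExpMom μ) {V : Type} [NormedAddCommGroup V] {h : X → V}
    (hc : Continuous h)
    (hb : ∃ K, 0 ≤ K ∧ ∀ u, ‖h u‖ ≤ exp (K * (1 + ‖u‖))) : Integrable h μ := by
  obtain ⟨K, _, h1⟩ := hb
  refine ((hμ K).const_mul (exp K)).mono' hc.aestronglyMeasurable
    (Filter.Eventually.of_forall fun u => ?_)
  rw [← Real.exp_add]
  convert h1 u using 2
  ring

theorem clm_mul_bd (ξ : X →L[ℝ] ℝ) {h : X → ℝ}
    (hb : ∃ K, 0 ≤ K ∧ ∀ u, ‖h u‖ ≤ exp (K * (1 + ‖u‖))) :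
    ∃ K, 0 ≤ K ∧ ∀ u, ‖ξ u * h u‖ ≤ exp (K * (1 + ‖u‖)) := by
  obtain ⟨K, hK, h1⟩ := hb
  refine ⟨‖ξ‖ + K, by positivity, fun u => ?_⟩
  rw [norm_mul, add_mul, Real.exp_add]
  gcongr
  · have := Real.add_one_le_exp (‖ξ‖ * (1 + ‖u‖))
    have := ξ.le_opNorm u
    have := norm_nonneg ξ
    nlinarith
  · exact h1 u

theorem apply_bd (e : X) {h' : Y → X →L[ℝ] ℝ}
    (hb : ∃ K, 0 ≤ K ∧ ∀ u, ‖h' u‖ ≤ exp (K * (1 + ‖u‖))) :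
    ∃ K, 0 ≤ K ∧ ∀ u, ‖h' u e‖ ≤ exp (K * (1 + ‖u‖)) := by
  obtain ⟨K, hK, h1⟩ := hb
  refine ⟨‖e‖ + K, by positivity, fun u => ?_⟩
  rw [add_mul, Real.exp_add]
  refine ((h' u).le_opNorm e).trans ?_
  rw [mul_comm]
  gcongr
  · have := Real.add_one_le_exp (‖e‖ * (1 + ‖u‖))
    have := norm_nonneg e
    have := norm_nonneg u
    nlinarith
  · exact h1 u

theorem Stein.prod_left {μ : Measure X} {ν : Measure Y} [IsProbabilityMeasure μ]
    [IsProbabilityMeasure ν] (hμ : ExpMom μ) (hν : ExpMom ν) {ξ : X →L[ℝ] ℝ} {e : X}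
    (H : Stein μ ξ e) :
    Stein (μ.prod ν) (ξ.comp (ContinuousLinearMap.fst ℝ X Y)) (e, 0) := by
  intro h h' hd hc hb hb'
  have hhc : Continuous h := continuous_iff_continuousAt.2 fun u => (hd u).continuousAt
  have hm := hμ.prod hν
  rw [integral_prod_symm _ (int_of_bd hm (by fun_prop) (clm_mul_bd _ hb)),
    integral_prod_symm _ (int_of_bd hm (by fun_prop) (apply_bd _ hb'))]
  congr 1
  ext y
  have e1 : ∀ (K : ℝ), 0 ≤ K → ∀ x : X, exp (K * (1 + ‖(x, y)‖)) ≤ exp ((K * (1 + ‖y‖)) * (1 + ‖x‖)) := by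
    intro K hK x
    apply Real.exp_le_exp.2
    rw [mul_assoc]
    apply mul_le_mul_of_nonneg_left _ hK
    have := norm_nonneg x
    have := norm_nonneg y
    have : ‖(x, y)‖ ≤ ‖x‖ + ‖y‖ := by
      rw [Prod.norm_def]; apply max_le <;> simp only <;> linarith
    nlinarith
  refine H (fun x => h (x, y)) (fun x => (h' (x, y)).comp (ContinuousLinearMap.inl ℝ X Y)) ?_ ?_ ?_ ?_
  · intro x
    have : HasFDerivAt (fun x : X => (x, y)) (ContinuousLinearMap.inl ℝ X Y) x :=
      hasFDerivAt_prodMk_left x y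
    exact (hd (x, y)).comp x this
  · fun_prop
  · obtain ⟨K, hK, h1⟩ := hb
    exact ⟨_, by positivity, fun x => (h1 (x, y)).trans (e1 K hK x)⟩
  · obtain ⟨K, hK, h1⟩ := hb'
    refine ⟨_, by positivity, fun x => le_trans ?_ ((h1 (x, y)).trans (e1 K hK x))⟩
    refine ((h' (x, y)).opNorm_comp_le _).trans ?_
    have := ContinuousLinearMap.norm_inl_le_one ℝ X Y
    nlinarith [norm_nonneg (h' (x, y))]

theorem Stein.map {μ : Measure X} {ν : Measure Y} (T : Y →L[ℝ] X) (hT : MeasurePreserving T ν μ)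
    {ξ : X →L[ℝ] ℝ} {e : Y} (H : Stein ν (ξ.comp T) e) : Stein μ ξ (T e) := by
  intro h h' hd hc hb hb'
  have hhc : Continuous h := continuous_iff_continuousAt.2 fun u => (hd u).continuousAt
  rw [← hT.map_eq, integral_map hT.aemeasurable
      (Continuous.aestronglyMeasurable (by fun_prop)), integral_map hT.aemeasurable
      (Continuous.aestronglyMeasurable (by fun_prop))]
  have e1 : ∀ (K : ℝ), 0 ≤ K → ∀ x : Y, exp (K * (1 + ‖T x‖)) ≤ exp ((K * (1 + ‖T‖)) * (1 + ‖x‖)) := by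
    intro K hK x
    apply Real.exp_le_exp.2
    rw [mul_assoc]
    apply mul_le_mul_of_nonneg_left _ hK
    have := norm_nonneg x
    have := norm_nonneg T
    have := T.le_opNorm x
    nlinarith
  refine H (fun x => h (T x)) (fun x => (h' (T x)).comp T) ?_ ?_ ?_ ?_
  · intro x
    exact (hd (T x)).comp x T.hasFDerivAt
  · fun_prop
  · obtain ⟨K, hK, h1⟩ := hb
    exact ⟨_, by positivity, fun x => (h1 (T x)).trans (e1 K hK x)⟩
  · obtain ⟨K, hK, h1⟩ := hb'
    refine ⟨‖T‖ + K * (1 + ‖T‖), by positivity, fun x => ?_⟩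
    refine ((h' (T x)).opNorm_comp_le _).trans ?_
    rw [mul_comm, add_mul, Real.exp_add]
    gcongr
    · have := Real.add_one_le_exp (‖T‖ * (1 + ‖x‖))
      have := norm_nonneg T
      have := norm_nonneg x
      nlinarith
    · exact (h1 (T x)).trans (e1 K hK x)

theorem Stein.prod_right {μ : Measure X} {ν : Measure Y} [IsProbabilityMeasure μ]
    [IsProbabilityMeasure ν] (hμ : ExpMom μ) (hν : ExpMom ν) {ξ : X →L[ℝ] ℝ} {e : X}
    (H : Stein μ ξ e) :
    Stein (ν.prod μ) (ξ.comp (ContinuousLinearMap.snd ℝ Y X)) (0, e) := by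
  have h1 := H.prod_left hμ hν
  refine Stein.map ((ContinuousLinearMap.snd ℝ X Y).prod (ContinuousLinearMap.fst ℝ X Y))
    (Measure.measurePreserving_swap) (ξ := ξ.comp (ContinuousLinearMap.snd ℝ Y X)) h1

instance : IsProbabilityMeasure stdG := by unfold stdG; infer_instance
instance (d : ℕ) : IsProbabilityMeasure (gVec d) := by unfold gVec; infer_instance
instance (a b : ℕ) : IsProbabilityMeasure (gMat a b) := by unfold gMat; infer_instance
instance (a b : ℕ) : IsProbabilityMeasure (muU a b) := by unfold muU; infer_instance
instance (c a b : ℕ) : IsProbabilityMeasure (muAll c a b) := by unfold muAll; infer_instance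

theorem expMom_stdG : ExpMom stdG := by
  intro K
  have h1 : Integrable (fun x : ℝ => exp (K * x)) stdG :=
    ProbabilityTheory.integrable_exp_mul_gaussianReal K
  have h2 : Integrable (fun x : ℝ => exp (-K * x)) stdG :=
    ProbabilityTheory.integrable_exp_mul_gaussianReal (-K)
  refine (h1.add h2).mono' (Continuous.aestronglyMeasurable (by fun_prop))
    (Filter.Eventually.of_forall fun x => ?_)
  rw [Real.norm_eq_abs, abs_of_pos (Real.exp_pos _)]
  simp only [Pi.add_apply, Real.norm_eq_abs]
  rcases abs_cases x with ⟨h, _⟩ | ⟨h, _⟩ <;> rw [h]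
  · linarith [Real.exp_pos (-K * x)]
  · have : K * -x = -K * x := by ring
    rw [this]
    linarith [Real.exp_pos (K * x)]

theorem expMom_gVec (d : ℕ) : ExpMom (gVec d) := expMom_stdG.pi
theorem expMom_gMat (a b : ℕ) : ExpMom (gMat a b) := (expMom_gVec b).pi
theorem expMom_muU (a b : ℕ) : ExpMom (muU a b) :=
  expMom_stdG.prod ((expMom_gVec a).prod (expMom_gVec b))

theorem stein_stdG : Stein stdG (ContinuousLinearMap.id ℝ ℝ) 1 := by
  intro h h' hd hc hb hb'
  have hhc : Continuous h := continuous_iff_continuousAt.2 fun u => (hd u).continuousAt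
  have i1 : Integrable (fun u => (ContinuousLinearMap.id ℝ ℝ) u * h u) stdG :=
    int_of_bd expMom_stdG (by fun_prop) (clm_mul_bd _ hb)
  have i2 : Integrable (fun u => h' u 1) stdG :=
    int_of_bd expMom_stdG (by fun_prop) (apply_bd _ hb')
  have i3 : Integrable h stdG := int_of_bd expMom_stdG hhc hb
  have hpdf : ∀ x : ℝ, HasDerivAt (ProbabilityTheory.gaussianPDFReal 0 1)
      (-x * ProbabilityTheory.gaussianPDFReal 0 1 x) x := by
    intro x
    have e : ProbabilityTheory.gaussianPDFReal 0 1 =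
        fun x : ℝ => (√(2 * π * ((1:NNReal):ℝ)))⁻¹ * exp (-(x - 0) ^ 2 / (2 * ((1:NNReal):ℝ))) := by
      ext x; rfl
    rw [e]
    have h1 : HasDerivAt (fun x : ℝ => -(x - 0) ^ 2 / (2 * ((1:NNReal):ℝ))) (-x) x := by
      have h2 := (((hasDerivAt_id x).sub_const 0).pow 2).neg.div_const (2 * ((1:NNReal):ℝ))
      refine h2.congr_deriv ?_
      simp [id]
      ring
    have := (h1.exp.const_mul (√(2 * π * ((1:NNReal):ℝ)))⁻¹)
    refine this.congr_deriv ?_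
    ring
  have conv : ∀ f : ℝ → ℝ, Integrable f stdG →
      Integrable (fun x => ProbabilityTheory.gaussianPDFReal 0 1 x * f x) := by
    intro f hf
    unfold stdG at hf
    rw [ProbabilityTheory.gaussianReal_of_var_ne_zero 0 one_ne_zero,
      integrable_withDensity_iff_integrable_smul' (ProbabilityTheory.measurable_gaussianPDF 0 1)
        (Filter.Eventually.of_forall fun x => ProbabilityTheory.gaussianPDF_lt_top)] at hf
    simpa [ProbabilityTheory.gaussianPDF,
      ENNReal.toReal_ofReal (ProbabilityTheory.gaussianPDFReal_nonneg 0 1 _)] using hf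
  have j1 := conv _ i1
  have j2 := conv _ i2
  have j3 := conv _ i3
  have hD : ∀ x, HasDerivAt h (h' x 1) x := fun x => (hd x).hasDerivAt
  have key := integral_mul_deriv_eq_deriv_mul_of_integrable
    (u := ProbabilityTheory.gaussianPDFReal 0 1) (v := h) (fun x _ => hpdf x) (fun x _ => hD x)
    j2 (by
      refine (j1.neg).congr (Filter.Eventually.of_forall fun x => ?_)
      simp only [Pi.neg_apply, Pi.mul_apply, ContinuousLinearMap.id_apply]
      ring) j3
  unfold stdG
  rw [ProbabilityTheory.integral_gaussianReal_eq_integral_smul one_ne_zero,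
    ProbabilityTheory.integral_gaussianReal_eq_integral_smul one_ne_zero]
  simp only [smul_eq_mul]
  rw [key, ← integral_neg]
  congr 1
  ext x
  simp only [ContinuousLinearMap.id_apply]
  ring

/-- insertion of a coordinate as a continuous linear map -/
def insL {d : ℕ} (i : Fin (d+1)) : ℝ × (Fin d → ℝ) →L[ℝ] (Fin (d+1) → ℝ) :=
  LinearMap.toContinuousLinearMap
    { toFun := fun w => i.insertNth w.1 w.2
      map_add' := by
        intro a b
        ext j
        refine Fin.succAboveCases i ?_ (fun k => ?_) j <;> simp
      map_smul' := by
        intro c a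
        ext j
        refine Fin.succAboveCases i ?_ (fun k => ?_) j <;> simp }

theorem insL_apply {d : ℕ} (i : Fin (d+1)) (w : ℝ × (Fin d → ℝ)) :
    insL i w = i.insertNth w.1 w.2 := rfl

theorem stein_gVec {d : ℕ} (i : Fin d) :
    Stein (gVec d) (ContinuousLinearMap.proj (R := ℝ) (φ := fun _ : Fin d => ℝ) i)
      (Pi.single i 1) := by
  cases d with
  | zero => exact i.elim0
  | succ d =>
    have hmp := (measurePreserving_piFinSuccAbove (fun _ : Fin (d+1) => stdG) i).symm
    have h1 := stein_stdG.prod_left expMom_stdG (expMom_gVec d)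
    have h2 : Stein (gVec (d+1)) (ContinuousLinearMap.proj (R := ℝ) (φ := fun _ : Fin (d+1) => ℝ) i)
      (insL i (1, 0)) := by
      refine Stein.map (ν := stdG.prod (gVec d)) (insL i) ?_ ?_
      · exact hmp
      · convert h1 using 1
        ext w <;> simp [insL_apply]
    convert h2 using 1
    rw [insL_apply]
    ext j
    refine Fin.succAboveCases i ?_ (fun k => ?_) j <;> simp

end stein

end part2

section part3
section levels

variable {P E X V A : Type}
  [NormedAddCommGroup P] [NormedSpace ℝ P]
  [NormedAddCommGroup E] [NormedSpace ℝ E]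
  [NormedAddCommGroup X] [NormedSpace ℝ X] [MeasurableSpace X] [BorelSpace X]
  [SecondCountableTopology X]
  [NormedAddCommGroup V] [NormedSpace ℝ V] [Fintype A]

/-- the Gaussian shift of one level -/
def shift (κ : A → P →L[ℝ] ℝ) (ξ : A → X →L[ℝ] ℝ) (e : A → E) (c : P) (u : X) : E :=
  ∑ a, (κ a c * ξ a u) • e a

/-- the shift map on the big space -/
def shiftMap (κ : A → P →L[ℝ] ℝ) (ξ : A → X →L[ℝ] ℝ) (e : A → E) (w : P × (E × X)) : P × E :=
  (w.1, w.2.1 + shift κ ξ e w.1 w.2.2)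

/-- averaging over one level -/
def Av (μ : Measure X) (κ : A → P →L[ℝ] ℝ) (ξ : A → X →L[ℝ] ℝ) (e : A → E)
    (g : P × E → V) (q : P × E) : V :=
  ∫ u, g (q.1, q.2 + shift κ ξ e q.1 u) ∂μ

variable (μ : Measure X) [IsProbabilityMeasure μ] (hμ : ExpMom μ)
  (κ : A → P →L[ℝ] ℝ) (ξ : A → X →L[ℝ] ℝ) (e : A → E)

theorem CG.shiftMap (N : ℕ) : CG N (shiftMap κ ξ e) := by
  have h1 : CG N (fun w : P × (E × X) =>
      ((ContinuousLinearMap.fst ℝ P (E × X)).prod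
        ((ContinuousLinearMap.fst ℝ E X).comp (ContinuousLinearMap.snd ℝ P (E × X)))) w) :=
    CG.clm N _
  have h2 : CG N (fun w : P × (E × X) => ∑ a, (κ a w.1 * ξ a w.2.2) • ((0, e a) : P × E)) := by
    refine CG.sum _ fun a _ => CG.smul (CG.mul ?_ ?_) (CG.const N _)
    · exact CG.clm N ((κ a).comp (ContinuousLinearMap.fst ℝ P (E × X)))
    · exact CG.clm N ((ξ a).comp ((ContinuousLinearMap.snd ℝ E X).comp
        (ContinuousLinearMap.snd ℝ P (E × X))))
  convert h1.add h2 using 1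
  ext1 w
  ext1
  · simp [SFLR.shiftMap, Prod.fst_sum]
  · simp [SFLR.shiftMap, shift, Prod.snd_sum]

theorem shiftMap_growth : ∀ R, ∃ R' K : ℝ, 0 ≤ K ∧ ∀ w : P × (E × X), ‖w.1‖ ≤ R →
    ‖(shiftMap κ ξ e w).1‖ ≤ R' ∧ ‖(shiftMap κ ξ e w).2‖ ≤ K * (1 + ‖w.2‖) := by
  intro R
  refine ⟨R, 1 + ∑ a, ‖κ a‖ * |R| * ‖ξ a‖ * ‖e a‖, by positivity, fun w hw => ⟨hw, ?_⟩⟩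
  have h1 : ‖w.2.1‖ ≤ ‖w.2‖ := norm_fst_le w.2
  have h2 : ‖w.2.2‖ ≤ ‖w.2‖ := norm_snd_le w.2
  have h3 : ‖shift κ ξ e w.1 w.2.2‖ ≤ (∑ a, ‖κ a‖ * |R| * ‖ξ a‖ * ‖e a‖) * ‖w.2‖ := by
    unfold shift
    rw [Finset.sum_mul]
    refine (norm_sum_le _ _).trans (Finset.sum_le_sum fun a _ => ?_)
    rw [norm_smul, norm_mul]
    have e1 := (κ a).le_opNorm w.1
    have e2 := (ξ a).le_opNorm w.2.2
    calc ‖κ a w.1‖ * ‖ξ a w.2.2‖ * ‖e a‖ ≤ (‖κ a‖ * |R|) * (‖ξ a‖ * ‖w.2‖) * ‖e a‖ := by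
          gcongr
          · refine e1.trans ?_
            gcongr
            exact hw.trans (le_abs_self R)
          · refine e2.trans ?_
            gcongr
      _ = _ := by ring
  have h4 : ‖(SFLR.shiftMap κ ξ e w).2‖ ≤ ‖w.2.1‖ + ‖shift κ ξ e w.1 w.2.2‖ := norm_add_le _ _
  have h5 : 0 ≤ ∑ a, ‖κ a‖ * |R| * ‖ξ a‖ * ‖e a‖ := by positivity
  have := norm_nonneg w.2
  nlinarith

theorem CG.comp_shift {N : ℕ} {g : P × E → V} (hg : CG N g) :
    CG N (fun w : P × (E × X) => g (w.1, w.2.1 + shift κ ξ e w.1 w.2.2)) :=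
  CG.comp (CG.shiftMap κ ξ e N) (shiftMap_growth κ ξ e) hg

include hμ in
theorem CG.Av {N : ℕ} {g : P × E → V} (hg : CG N g) : CG N (Av μ κ ξ e g) :=
  CG.integral μ hμ (hg.comp_shift κ ξ e)

include hμ in
theorem Av_integrable {g : P × E → V} (hg : CG 0 g) (q : P × E) :
    Integrable (fun u => g (q.1, q.2 + shift κ ξ e q.1 u)) μ :=
  EG.integrable μ hμ (hg.comp_shift κ ξ e).cont (hg.comp_shift κ ξ e).eg q

include hμ in
theorem PG.Av {N : ℕ} {g : P × E → ℝ} (hg : PG N g) : PG N (SFLR.Av μ κ ξ e g) := by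
  have : PG N (fun w : P × (E × X) => g (w.1, w.2.1 + shift κ ξ e w.1 w.2.2)) := by
    refine ⟨fun w => hg.pos _, hg.cg.comp_shift κ ξ e, ?_⟩
    have h0 : PG 0 g := ⟨hg.pos, hg.cg.zero, hg.inv⟩
    exact (h0.inv'.comp_shift κ ξ e).eg
  exact PG.integral μ hμ this

theorem hasFDerivAt_shiftMap (w : P × (E × X)) : ∃ T' : P × (E × X) →L[ℝ] P × E,
    HasFDerivAt (shiftMap κ ξ e) T' w ∧
    ∀ (δ : P) (z : E), T' (δ, (z, 0)) = (δ, z + shift κ ξ e δ w.2.2) := by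
  have h1 : HasFDerivAt (fun w : P × (E × X) => w.1) (ContinuousLinearMap.fst ℝ P (E × X)) w :=
    hasFDerivAt_fst
  have h2 : HasFDerivAt (fun w : P × (E × X) => w.2.1)
      ((ContinuousLinearMap.fst ℝ E X).comp (ContinuousLinearMap.snd ℝ P (E × X))) w :=
    hasFDerivAt_fst.comp w hasFDerivAt_snd
  have h3 : HasFDerivAt (fun w : P × (E × X) => w.2.2)
      ((ContinuousLinearMap.snd ℝ E X).comp (ContinuousLinearMap.snd ℝ P (E × X))) w :=
    hasFDerivAt_snd.comp w hasFDerivAt_snd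
  have h4 : ∀ a, HasFDerivAt (fun w : P × (E × X) => (κ a w.1 * ξ a w.2.2) • e a) _ w := fun a =>
    (((κ a).hasFDerivAt.comp w h1).mul ((ξ a).hasFDerivAt.comp w h3)).smul_const (e a)
  have h5 := HasFDerivAt.fun_sum (u := Finset.univ) (fun a _ => h4 a)
  refine ⟨_, h1.prodMk (h2.add h5), fun δ z => ?_⟩
  ext1
  · simp
  · simp [shift, mul_comm]

include hμ in
theorem dd_Av {g : P × E → ℝ} (hg : CG 1 g) (δ : P) (z : E) (q : P × E) :
    dd (δ, z) (Av μ κ ξ e g) q =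
      ∫ u, fderiv ℝ g (q.1, q.2 + shift κ ξ e q.1 u) (δ, z + shift κ ξ e δ u) ∂μ := by
  have hk := hg.comp_shift (X := X) κ ξ e
  have h1 := hasFDerivAt_avg μ hμ hk q
  unfold dd
  have h2 : fderiv ℝ (Av μ κ ξ e g) q = _ := h1.fderiv
  rw [h2, ContinuousLinearMap.integral_apply]
  · congr 1
    ext u
    obtain ⟨T', hT, hT'⟩ := hasFDerivAt_shiftMap κ ξ e (q.1, (q.2, u))
    have h3 : HasFDerivAt (fun w : P × (E × X) => g (w.1, w.2.1 + shift κ ξ e w.1 w.2.2)) _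
      (q.1, (q.2, u)) :=
      (hg.2.1 (q.1, q.2 + shift κ ξ e q.1 u)).hasFDerivAt.comp (q.1, (q.2, u)) hT
    rw [h3.fderiv]
    have h4 : iotaL (X := X) (δ, z) = (δ, (z, 0)) := rfl
    simp only [ContinuousLinearMap.comp_apply, h4, hT']
  · have hk' : CG 0 (fun w => (fderiv ℝ (fun w : P × (E × X) =>
        g (w.1, w.2.1 + shift κ ξ e w.1 w.2.2)) w).comp (iotaL (P := P) (Z := E) (X := X))) :=
      CG.clm_comp ((ContinuousLinearMap.compL ℝ (P × E) (P × (E × X)) ℝ).flip iotaL) hk.2.2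
    exact EG.integrable μ hμ hk'.cont hk'.eg q

include hμ in
theorem dd_Av_z {g : P × E → ℝ} (hg : CG 1 g) (z : E) :
    dd (0, z) (Av μ κ ξ e g) = Av μ κ ξ e (dd (0, z) g) := by
  ext q
  rw [dd_Av μ hμ κ ξ e hg]
  have : ∀ u, shift κ ξ e 0 u = 0 := fun u => by simp [shift]
  simp only [this, add_zero]
  rfl

/-- normalised dual system for the Stein identity -/
def SteinOne (μ : Measure X) (ξ : A → X →L[ℝ] ℝ) : Prop :=
  ∃ ε : A → X, (∀ a, Stein μ (ξ a) (ε a)) ∧ (∀ a b, b ≠ a → ξ b (ε a) = 0) ∧ ∀ a, ξ a (ε a) = 1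

theorem bd_of_EG {k : P × (E × X) → V} (hk : EG k) (q : P × E) :
    ∃ K, 0 ≤ K ∧ ∀ u, ‖k (q.1, (q.2, u))‖ ≤ exp (K * (1 + ‖u‖)) := by
  obtain ⟨K, hK, h⟩ := hk ‖q.1‖
  refine ⟨K * (1 + ‖q.2‖), by positivity, fun u => (h (q.1, (q.2, u)) le_rfl).trans ?_⟩
  apply Real.exp_le_exp.2
  rw [mul_assoc]
  apply mul_le_mul_of_nonneg_left _ hK
  have h1 := norm_nonneg q.2
  have h2 := norm_nonneg u
  have : ‖(q.2, u)‖ ≤ ‖q.2‖ + ‖u‖ := by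
    rw [Prod.norm_def]; apply max_le <;> simp only <;> linarith
  simp only
  nlinarith

include hμ in
theorem stein_Av (hS : SteinOne μ ξ) {f : P × E → ℝ} (hf : CG 1 f) (q : P × E) (a : A) :
    ∫ u, ξ a u * f (q.1, q.2 + shift κ ξ e q.1 u) ∂μ =
      κ a q.1 * Av μ κ ξ e (dd (0, e a) f) q := by
  obtain ⟨ε, h1, h2, h3⟩ := hS
  let T : X →L[ℝ] P × E := ∑ b, (κ b q.1) • (ξ b).smulRight ((0, e b) : P × E)
  have hT : ∀ u, T u = (0, shift κ ξ e q.1 u) := by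
    intro u
    ext1
    · simp [T, Prod.fst_sum]
    · simp [T, Prod.snd_sum, shift, smul_smul]
  have hTe : T (ε a) = κ a q.1 • (0, e a) := by
    rw [hT]
    unfold shift
    rw [Finset.sum_eq_single a]
    · simp [h3]
    · intro b _ hb
      simp [h2 a b hb]
    · simp
  have hdv : ∀ u, HasFDerivAt (fun u => f (q.1, q.2 + shift κ ξ e q.1 u))
      ((fderiv ℝ f (q.1, q.2 + shift κ ξ e q.1 u)).comp T) u := by
    intro u
    have e1 : HasFDerivAt (fun u => (q.1, q.2 + shift κ ξ e q.1 u)) T u := by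
      have e2 : (fun u => (q.1, q.2 + shift κ ξ e q.1 u)) = fun u => q + T u := by
        ext1 u
        rw [hT]
        ext1 <;> simp
      rw [e2]
      exact T.hasFDerivAt.const_add q
    exact (hf.2.1 _).hasFDerivAt.comp u e1
  have hk1 := hf.comp_shift (X := X) κ ξ e
  have hk2 : CG 0 (fun w : P × (E × X) => fderiv ℝ f (w.1, w.2.1 + shift κ ξ e w.1 w.2.2)) :=
    hf.2.2.comp_shift κ ξ e
  have hk3 : CG 0 (fun w : P × (E × X) =>
      (fderiv ℝ f (w.1, w.2.1 + shift κ ξ e w.1 w.2.2)).comp T) :=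
    CG.clm_comp ((ContinuousLinearMap.compL ℝ X (P × E) ℝ).flip T) hk2
  have := h1 a _ _ hdv (hk3.cont.comp (by fun_prop : Continuous fun u : X => (q.1, (q.2, u))))
    (bd_of_EG hk1.eg q) (bd_of_EG hk3.eg q)
  rw [this]
  unfold Av
  rw [← integral_const_mul]
  congr 1
  ext u
  rw [ContinuousLinearMap.comp_apply, hTe, map_smul]
  rfl

include hμ in
/-- the heat equation -/
theorem heat (hS : SteinOne μ ξ) {g : P × E → ℝ} (hg : CG 2 g) (q : P × E) (δ : P) :
    dd (δ, 0) (Av μ κ ξ e g) q = Av μ κ ξ e (dd (δ, 0) g) q +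
      ∑ a, κ a q.1 * κ a δ * Av μ κ ξ e (dd (0, e a) (dd (0, e a) g)) q := by
  rw [dd_Av μ hμ κ ξ e hg.pred]
  have e1 : ∀ u, fderiv ℝ g (q.1, q.2 + shift κ ξ e q.1 u) (δ, 0 + shift κ ξ e δ u) =
      dd (δ, 0) g (q.1, q.2 + shift κ ξ e q.1 u) +
      ∑ a, κ a δ * (ξ a u * dd (0, e a) g (q.1, q.2 + shift κ ξ e q.1 u)) := by
    intro u
    have e2 : ((δ, 0 + shift κ ξ e δ u) : P × E) =
        (δ, 0) + ∑ a, (κ a δ * ξ a u) • ((0, e a) : P × E) := by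
      ext1
      · simp [Prod.fst_sum]
      · simp [Prod.snd_sum, shift]
    rw [e2, map_add, map_sum]
    simp only [map_smul, smul_eq_mul, mul_assoc]
    rfl
  simp only [e1]
  have i2 : ∀ a, Integrable (fun u => ξ a u * dd (0, e a) g (q.1, q.2 + shift κ ξ e q.1 u)) μ := by
    intro a
    have hk : CG 0 (fun w : P × (E × X) =>
        ((ξ a).comp ((ContinuousLinearMap.snd ℝ E X).comp (ContinuousLinearMap.snd ℝ P (E × X)))) w
          * dd (0, e a) g (w.1, w.2.1 + shift κ ξ e w.1 w.2.2)) :=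
      (CG.clm 0 _).mul ((hg.dd (0, e a)).zero.comp_shift κ ξ e)
    exact EG.integrable μ hμ hk.cont hk.eg q
  rw [integral_add (Av_integrable μ hμ κ ξ e (hg.dd (δ, 0)).zero q)
    (integrable_finsetSum _ fun a _ => (i2 a).const_mul _),
    integral_finsetSum _ (fun a _ => (i2 a).const_mul _)]
  congr 1
  refine Finset.sum_congr rfl fun a _ => ?_
  rw [integral_const_mul, stein_Av μ hμ κ ξ e hS (hg.dd (0, e a))]
  ring

theorem dd_comp {f : P × E → ℝ} (hf : Differentiable ℝ f) (hpos : ∀ q, 0 < f q) {φ φ' : ℝ → ℝ}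
    (hφ : ∀ x, 0 < x → HasDerivAt φ (φ' x) x) (v : P × E) :
    dd v (fun q => φ (f q)) = fun q => φ' (f q) * dd v f q := by
  ext q
  have this : HasFDerivAt (fun q => φ (f q)) (φ' (f q) • fderiv ℝ f q) q :=
    (hφ (f q) (hpos q)).comp_hasFDerivAt q (hf q).hasFDerivAt
  unfold dd
  rw [this.fderiv]
  simp

theorem dd_mul {f g : P × E → ℝ} (hf : Differentiable ℝ f) (hg : Differentiable ℝ g) (v : P × E) :
    dd v (fun q => f q * g q) = fun q => f q * dd v g q + dd v f q * g q := by
  ext q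
  unfold dd
  rw [fderiv_fun_mul (hf q) (hg q)]
  simp
  ring

include hμ in
/-- two-level cancellation -/
theorem two_level (hS : SteinOne μ ξ) {f : P × E → ℝ} (hf : PG 2 f) {φ φ' φ'' : ℝ → ℝ}
    (hφ : ∀ x, 0 < x → HasDerivAt φ (φ' x) x) (hφ' : ∀ x, 0 < x → HasDerivAt φ' (φ'' x) x)
    (hg : CG 2 (fun q => φ (f q))) (c δ : P)
    (hz : ∀ z, dd (δ, 0) f (c, z) = - ∑ a, κ a c * κ a δ * dd (0, e a) (dd (0, e a) f) (c, z))
    (z : E) :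
    dd (δ, 0) (Av μ κ ξ e (fun q => φ (f q))) (c, z) =
      Av μ κ ξ e (fun q => φ'' (f q) * ∑ a, κ a c * κ a δ * (dd (0, e a) f q) ^ 2) (c, z) := by
  rw [heat μ hμ κ ξ e hS hg]
  have hfd : Differentiable ℝ f := hf.cg.2.1
  have hφf : Differentiable ℝ (fun q => φ' (f q)) := fun q =>
    ((hφ' (f q) (hf.pos q)).comp_hasFDerivAt q (hfd q).hasFDerivAt).differentiableAt
  have d2 : ∀ a, dd (0, e a) (dd (0, e a) (fun q => φ (f q))) = fun q =>
      φ' (f q) * dd (0, e a) (dd (0, e a) f) q + φ'' (f q) * (dd (0, e a) f q) ^ 2 := by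
    intro a
    rw [dd_comp hfd hf.pos hφ, dd_mul hφf (hf.cg.dd _).2.1, dd_comp hfd hf.pos hφ']
    ext q
    ring
  have i1 := Av_integrable μ hμ κ ξ e (hg.dd (δ, 0)).zero (c, z)
  have i2 := fun a => Av_integrable μ hμ κ ξ e ((hg.dd (0, e a)).dd (0, e a)) (c, z)
  unfold Av
  simp only [← integral_const_mul]
  rw [← integral_finsetSum _ (fun a _ => (i2 a).const_mul _),
    ← integral_add i1 (integrable_finsetSum _ fun a _ => (i2 a).const_mul _)]
  congr 1
  ext u
  rw [dd_comp hfd hf.pos hφ (δ, 0)]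
  simp only [d2]
  rw [hz]
  simp only [mul_add, Finset.sum_add_distrib, Finset.mul_sum]
  simp only [mul_neg, Finset.mul_sum]
  rw [← add_assoc, add_eq_right.2]
  · refine Finset.sum_congr rfl fun a _ => by ring
  · rw [neg_add_eq_zero]
    refine Finset.sum_congr rfl fun a _ => by ring

include hμ in
/-- If the level does not see `δ`, derivatives pass through. -/
theorem dd_Av_pass {g : P × E → ℝ} (hg : CG 1 g) (δ : P) (h0 : ∀ a, κ a δ = 0) :
    dd (δ, 0) (Av μ κ ξ e g) = Av μ κ ξ e (dd (δ, 0) g) := by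
  ext q
  rw [dd_Av μ hμ κ ξ e hg]
  have : ∀ u, shift κ ξ e δ u = 0 := fun u => by simp [shift, h0]
  simp only [this, add_zero]
  rfl

end levels

end part3

section part4
section chain

variable {P E X A : Type}
  [NormedAddCommGroup P] [NormedSpace ℝ P]
  [NormedAddCommGroup E] [NormedSpace ℝ E]
  [NormedAddCommGroup X] [NormedSpace ℝ X] [MeasurableSpace X] [BorelSpace X]
  [SecondCountableTopology X] [Fintype A]

variable (μ : Measure X) [IsProbabilityMeasure μ] (hμ : ExpMom μ)
  (K : ℕ → A → P →L[ℝ] ℝ) (ξ : A → X →L[ℝ] ℝ) (e : A → E) (mv : ℕ → ℝ) (z0 : P × E → ℝ)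

/-- abstract version of `ζ_k` -/
def Zt : ℕ → P × E → ℝ
  | 0 => z0
  | k+1 => Av μ (K k) ξ e (fun q => Zt k q ^ (mv (k+1) / mv k))

/-- abstract version of `Φ_{k+1}` -/
def Ph (k : ℕ) (f : P × E → ℝ) : P × E → ℝ := fun q =>
  Av μ (K k) ξ e (fun q => Zt μ K ξ e mv z0 k q ^ (mv (k+1) / mv k) * f q) q /
    Zt μ K ξ e mv z0 (k+1) q

/-- abstract version of the composed operators -/
def PhUp (lo : ℕ) : ℕ → (P × E → ℝ) → P × E → ℝ
  | 0, f => f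
  | hi+1, f => if hi + 1 < lo then f else Ph μ K ξ e mv z0 hi (PhUp lo hi f)

theorem PhUp_of_lt {lo hi : ℕ} (h : hi < lo) (f : P × E → ℝ) :
    PhUp μ K ξ e mv z0 lo hi f = f := by
  cases hi with
  | zero => rfl
  | succ k => simp [PhUp, h]

theorem PhUp_succ {lo hi : ℕ} (h : lo ≤ hi + 1) (f : P × E → ℝ) :
    PhUp μ K ξ e mv z0 lo (hi+1) f = Ph μ K ξ e mv z0 hi (PhUp μ K ξ e mv z0 lo hi f) := by
  simp [PhUp, not_lt.2 h]

variable {z0}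

include hμ in
theorem PG.Zt (h0 : PG 2 z0) (k : ℕ) : PG 2 (Zt μ K ξ e mv z0 k) := by
  induction k with
  | zero => exact h0
  | succ k ih => exact PG.Av μ hμ (K k) ξ e (ih.rpow' _)

include hμ in
theorem CG.Ph (h0 : PG 2 z0) (k : ℕ) {f : P × E → ℝ} (hf : CG 0 f) :
    CG 0 (Ph μ K ξ e mv z0 k f) := by
  have h1 := CG.Av μ hμ (K k) ξ e (((PG.Zt μ hμ K ξ e mv h0 k).rpow (mv (k+1) / mv k)).zero.mul hf)
  exact h1.mul (PG.Zt μ hμ K ξ e mv h0 (k+1)).inv'.zero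

include hμ in
theorem CG.PhUp (h0 : PG 2 z0) (lo hi : ℕ) {f : P × E → ℝ} (hf : CG 0 f) :
    CG 0 (PhUp μ K ξ e mv z0 lo hi f) := by
  induction hi with
  | zero => exact hf
  | succ k ih =>
    by_cases h : k + 1 < lo
    · rw [PhUp_of_lt _ _ _ _ _ _ h]; exact hf
    · rw [PhUp_succ _ _ _ _ _ _ (not_lt.1 h)]
      exact CG.Ph μ hμ K ξ e mv h0 k ih

include hμ in
theorem Ph_sum (h0 : PG 2 z0) (k : ℕ) {ι : Type} (S : Finset ι) (w : ι → ℝ) {f : ι → P × E → ℝ}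
    (hf : ∀ i, CG 0 (f i)) :
    Ph μ K ξ e mv z0 k (fun q => ∑ i ∈ S, w i * f i q) =
      fun q => ∑ i ∈ S, w i * Ph μ K ξ e mv z0 k (f i) q := by
  ext q
  have hz := ((PG.Zt μ hμ K ξ e mv h0 k).rpow (mv (k+1) / mv k)).zero
  have hi := fun i => Av_integrable μ hμ (K k) ξ e (hz.mul (hf i)) q
  unfold SFLR.Ph
  simp only [← mul_div_assoc]
  rw [← Finset.sum_div]
  congr 1
  unfold Av
  simp only [← integral_const_mul]
  rw [← integral_finsetSum _ (fun i _ => (hi i).const_mul _)]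
  congr 1
  ext u
  rw [Finset.mul_sum]
  refine Finset.sum_congr rfl fun i _ => by ring

include hμ in
theorem PhUp_sum (h0 : PG 2 z0) (lo hi : ℕ) {ι : Type} (S : Finset ι) (w : ι → ℝ)
    {f : ι → P × E → ℝ} (hf : ∀ i, CG 0 (f i)) :
    PhUp μ K ξ e mv z0 lo hi (fun q => ∑ i ∈ S, w i * f i q) =
      fun q => ∑ i ∈ S, w i * PhUp μ K ξ e mv z0 lo hi (f i) q := by
  induction hi with
  | zero => rfl
  | succ k ih =>
    by_cases h : k + 1 < lo
    · simp only [PhUp_of_lt _ _ _ _ _ _ h]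
    · simp only [PhUp_succ _ _ _ _ _ _ (not_lt.1 h)]
      rw [ih, Ph_sum μ hμ K ξ e mv h0 k S w (fun i => CG.PhUp μ hμ K ξ e mv h0 lo k (hf i))]

theorem Av_congr (k : A → P →L[ℝ] ℝ) {f g : P × E → ℝ} {c : P} (h : ∀ z, f (c, z) = g (c, z))
    (z : E) : Av μ k ξ e f (c, z) = Av μ k ξ e g (c, z) := by
  unfold Av
  simp only [h]

theorem Av_const_mul (k : A → P →L[ℝ] ℝ) (f : P × E → ℝ) (a : ℝ) (q : P × E) :
    Av μ k ξ e (fun q => a * f q) q = a * Av μ k ξ e f q := by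
  unfold Av
  rw [integral_const_mul]

theorem rpow_hasDeriv (a : ℝ) : ∀ x : ℝ, 0 < x → HasDerivAt (fun x => x ^ a) (a * x ^ (a-1)) x :=
  fun x hx => Real.hasDerivAt_rpow_const (Or.inl hx.ne')

include hμ in
/-- spatial derivatives are Gibbs averages -/
theorem dd_Zt_z (h0 : PG 2 z0) (r : ℕ) (hm0 : mv 0 = 1) (hm : ∀ k ≤ r, 0 < mv k) (b : E) (σ : ℝ)
    (g0 : P × E → ℝ) (hg : dd (0, b) z0 = fun q => σ * z0 q * g0 q) (j : ℕ) (hj : j ≤ r) :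
    dd (0, b) (Zt μ K ξ e mv z0 j) =
      fun q => σ * mv j * Zt μ K ξ e mv z0 j q * PhUp μ K ξ e mv z0 1 j g0 q := by
  induction j with
  | zero => simp only [Zt, hg, hm0, PhUp, mul_one]
  | succ j ih =>
    have ih := ih (by omega)
    have hZ := PG.Zt μ hμ K ξ e mv h0 j
    have hZ1 := PG.Zt μ hμ K ξ e mv h0 (j+1)
    rw [PhUp_succ _ _ _ _ _ _ (by omega)]
    show dd (0, b) (Av μ (K j) ξ e (fun q => Zt μ K ξ e mv z0 j q ^ (mv (j+1) / mv j))) = _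
    rw [dd_Av_z μ hμ (K j) ξ e (hZ.rpow _).pred,
      dd_comp hZ.cg.2.1 hZ.pos (rpow_hasDeriv _), ih]
    ext q
    have hne := (hZ1.pos q).ne'
    unfold Ph
    rw [mul_assoc (σ * mv (j+1)), mul_div_cancel₀ _ hne, ← Av_const_mul]
    obtain ⟨c, z⟩ := q
    refine Av_congr μ ξ e _ (fun z => ?_) z
    have hp := hZ.pos (c, z)
    have hmj := hm j (by omega)
    rw [Real.rpow_sub_one hp.ne']
    field_simp

variable (c δ : P) (k : ℕ)

include hμ in
theorem dd_Zt_low (h0 : PG 2 z0) (hz0 : dd (δ, 0) z0 = 0) (hlow : ∀ j < k, ∀ a, K j a δ = 0)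
    (j : ℕ) (hj : j ≤ k) : dd (δ, 0) (Zt μ K ξ e mv z0 j) = 0 := by
  induction j with
  | zero => exact hz0
  | succ j ih =>
    have hZ := PG.Zt μ hμ K ξ e mv h0 j
    show dd (δ, 0) (Av μ (K j) ξ e (fun q => Zt μ K ξ e mv z0 j q ^ (mv (j+1) / mv j))) = _
    rw [dd_Av_pass μ hμ (K j) ξ e (hZ.rpow _).pred δ (hlow j (by omega)),
      dd_comp hZ.cg.2.1 hZ.pos (rpow_hasDeriv _), ih (by omega)]
    ext q
    simp [Av]

include hμ in
theorem dd_Zt_heat (hS : SteinOne μ ξ) (h0 : PG 2 z0) (hz0 : dd (δ, 0) z0 = 0)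
    (hlow : ∀ j < k, ∀ a, K j a δ = 0)
    (hK : ∀ a, K k a c * K k a δ = - (K (k+1) a c * K (k+1) a δ)) (z : E) :
    dd (δ, 0) (Zt μ K ξ e mv z0 (k+1)) (c, z) = - ∑ a, K (k+1) a c * K (k+1) a δ *
      dd (0, e a) (dd (0, e a) (Zt μ K ξ e mv z0 (k+1))) (c, z) := by
  have hZ := PG.Zt μ hμ K ξ e mv h0 k
  have hc := hZ.rpow (mv (k+1) / mv k)
  show dd (δ, 0) (Av μ (K k) ξ e (fun q => Zt μ K ξ e mv z0 k q ^ (mv (k+1) / mv k))) (c, z) =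
    - ∑ a, K (k+1) a c * K (k+1) a δ * dd (0, e a) (dd (0, e a)
      (Av μ (K k) ξ e (fun q => Zt μ K ξ e mv z0 k q ^ (mv (k+1) / mv k)))) (c, z)
  rw [heat μ hμ (K k) ξ e hS hc]
  simp only [dd_Av_z μ hμ (K k) ξ e hc.pred, fun a => dd_Av_z μ hμ (K k) ξ e (hc.dd (0, e a)),
    hK]
  rw [dd_comp hZ.cg.2.1 hZ.pos (rpow_hasDeriv _) (δ, 0),
    dd_Zt_low μ hμ K ξ e mv δ k h0 hz0 hlow k le_rfl]
  simp [Av, Finset.sum_neg_distrib]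

/-- the source term -/
def Fst (q : P × E) : ℝ := (mv (k+2) - mv (k+1)) * ∑ a, K (k+1) a c * K (k+1) a δ *
    (dd (0, e a) (Zt μ K ξ e mv z0 (k+1)) q / (mv (k+1) * Zt μ K ξ e mv z0 (k+1) q)) ^ 2

include hμ in
theorem dd_Zt_high (hS : SteinOne μ ξ) (h0 : PG 2 z0) (hz0 : dd (δ, 0) z0 = 0)
    (hlow : ∀ j < k, ∀ a, K j a δ = 0) (hhigh : ∀ j, k + 2 ≤ j → ∀ a, K j a δ = 0)
    (hK : ∀ a, K k a c * K k a δ = - (K (k+1) a c * K (k+1) a δ))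
    (r : ℕ) (hm : ∀ k ≤ r, 0 < mv k) (j : ℕ) (hkj : k + 2 ≤ j) (hj : j ≤ r) : ∀ z : E,
    dd (δ, 0) (Zt μ K ξ e mv z0 j) (c, z) = mv j * (Zt μ K ξ e mv z0 j (c, z) *
      PhUp μ K ξ e mv z0 (k+2) j (Fst μ K ξ e mv (z0 := z0) c δ k) (c, z)) := by
  induction j, hkj using Nat.le_induction with
  | base =>
    intro z
    have hZ := PG.Zt μ hμ K ξ e mv h0 (k+1)
    have hZ1 := PG.Zt μ hμ K ξ e mv h0 (k+2)
    rw [PhUp_succ _ _ _ _ _ _ le_rfl, PhUp_of_lt _ _ _ _ _ _ (by omega)]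
    unfold Ph
    rw [mul_div_cancel₀ _ (hZ1.pos _).ne', ← Av_const_mul]
    have hφ' : ∀ x : ℝ, 0 < x → HasDerivAt
        (fun x => mv (k+2) / mv (k+1) * x ^ (mv (k+2) / mv (k+1) - 1))
        (mv (k+2) / mv (k+1) * ((mv (k+2) / mv (k+1) - 1) *
          x ^ (mv (k+2) / mv (k+1) - 1 - 1))) x :=
      fun x hx => (rpow_hasDeriv _ x hx).const_mul _
    refine (two_level μ hμ (K (k+1)) ξ e hS hZ (rpow_hasDeriv _) hφ'
      (hZ.rpow (mv (k+2) / mv (k+1))) c δ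
      (dd_Zt_heat μ hμ K ξ e mv c δ k hS h0 hz0 hlow hK) z).trans ?_
    refine Av_congr μ ξ e _ (fun z => ?_) z
    have hp := hZ.pos (c, z)
    have hmj := hm (k+1) (by omega)
    have hmj2 := hm (k+2) (by omega)
    rw [Real.rpow_sub_one hp.ne', Real.rpow_sub_one hp.ne']
    unfold Fst
    simp only [Finset.mul_sum]
    refine Finset.sum_congr rfl fun a _ => ?_
    field_simp
  | succ j hkj ih =>
    intro z
    have ih := ih (by omega)
    have hZ := PG.Zt μ hμ K ξ e mv h0 j
    have hZ1 := PG.Zt μ hμ K ξ e mv h0 (j+1)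
    rw [PhUp_succ _ _ _ _ _ _ (by omega)]
    unfold Ph
    rw [mul_div_cancel₀ _ (hZ1.pos _).ne', ← Av_const_mul]
    show dd (δ, 0) (Av μ (K j) ξ e (fun q => Zt μ K ξ e mv z0 j q ^ (mv (j+1) / mv j))) _ = _
    rw [dd_Av_pass μ hμ (K j) ξ e (hZ.rpow _).pred δ (hhigh j (by omega)),
      dd_comp hZ.cg.2.1 hZ.pos (rpow_hasDeriv _)]
    refine Av_congr μ ξ e _ (fun z => ?_) z
    have hp := hZ.pos (c, z)
    have hmj := hm j (by omega)
    rw [Real.rpow_sub_one hp.ne', ih]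
    field_simp

include hμ in
theorem dd_final (hS : SteinOne μ ξ) (h0 : PG 2 z0) (hz0 : dd (δ, 0) z0 = 0)
    (hlow : ∀ j < k, ∀ a, K j a δ = 0) (hhigh : ∀ j, k + 2 ≤ j → ∀ a, K j a δ = 0)
    (hK : ∀ a, K k a c * K k a δ = - (K (k+1) a c * K (k+1) a δ))
    (r : ℕ) (hm : ∀ k ≤ r, 0 < mv k) (hmr : mv (r+1) = 0) (hkr : k + 1 ≤ r) (z : E) :
    dd (δ, 0) (Av μ (K r) ξ e (fun q => Real.log (Zt μ K ξ e mv z0 r q))) (c, z) =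
      mv r * Av μ (K r) ξ e (PhUp μ K ξ e mv z0 (k+2) r
        (Fst μ K ξ e mv (z0 := z0) c δ k)) (c, z) := by
  have hZ := PG.Zt μ hμ K ξ e mv h0 r
  have hlog : ∀ x : ℝ, 0 < x → HasDerivAt Real.log (x⁻¹) x :=
    fun x hx => Real.hasDerivAt_log hx.ne'
  rw [← Av_const_mul]
  rcases hkr.eq_or_lt with h | h
  · subst h
    rw [PhUp_of_lt _ _ _ _ _ _ (by omega)]
    have hinv : ∀ x : ℝ, 0 < x → HasDerivAt (fun x : ℝ => x⁻¹) (-(x ^ 2)⁻¹) x :=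
      fun x hx => hasDerivAt_inv hx.ne'
    refine (two_level μ hμ (K (k+1)) ξ e hS hZ hlog hinv hZ.log c δ
      (dd_Zt_heat μ hμ K ξ e mv c δ k hS h0 hz0 hlow hK) z).trans ?_
    refine Av_congr μ ξ e _ (fun z => ?_) z
    have hp := hZ.pos (c, z)
    have hmj := hm (k+1) (by omega)
    unfold Fst
    have : mv (k+2) = 0 := hmr
    rw [this]
    simp only [Finset.mul_sum]
    refine Finset.sum_congr rfl fun a _ => ?_
    field_simp
    ring
  · rw [dd_Av_pass μ hμ (K r) ξ e hZ.log.pred δ (hhigh r (by omega)),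
      dd_comp hZ.cg.2.1 hZ.pos hlog]
    refine Av_congr μ ξ e _ (fun z => ?_) z
    have hp := hZ.pos (c, z)
    rw [dd_Zt_high μ hμ K ξ e mv c δ k hS h0 hz0 hlow hhigh hK r hm r (by omega) le_rfl]
    field_simp

end chain

end part4

section part5
section concrete

/-- index set of the Gaussian coordinates of one group -/
abbrev Ax (m n : ℕ) : Type := Unit ⊕ (Fin m ⊕ Fin n)
/-- parameter space -/
abbrev Px (r : ℕ) : Type := Fin (r+1) → Fin 3 → ℝ
/-- field space -/
abbrev Ex (l : ℕ) : Type := Fin l → Fin l → ℝ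

/-- the type of a coordinate -/
def tyA (m n : ℕ) : Ax m n → Fin 3
  | Sum.inl _ => 0
  | Sum.inr (Sum.inl _) => 1
  | Sum.inr (Sum.inr _) => 2

/-- coordinate functionals -/
def xiA (m n : ℕ) : Ax m n → Us m n →L[ℝ] ℝ
  | Sum.inl _ => (ContinuousLinearMap.id ℝ ℝ).comp
      (ContinuousLinearMap.fst ℝ ℝ ((Fin m → ℝ) × (Fin n → ℝ)))
  | Sum.inr (Sum.inl j) => ((ContinuousLinearMap.proj (R := ℝ) (φ := fun _ : Fin m => ℝ) j).comp
      (ContinuousLinearMap.fst ℝ (Fin m → ℝ) (Fin n → ℝ))).comp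
      (ContinuousLinearMap.snd ℝ ℝ ((Fin m → ℝ) × (Fin n → ℝ)))
  | Sum.inr (Sum.inr j) => ((ContinuousLinearMap.proj (R := ℝ) (φ := fun _ : Fin n => ℝ) j).comp
      (ContinuousLinearMap.snd ℝ (Fin m → ℝ) (Fin n → ℝ))).comp
      (ContinuousLinearMap.snd ℝ ℝ ((Fin m → ℝ) × (Fin n → ℝ)))

/-- coefficient functionals -/
def KA (r m n : ℕ) (k : ℕ) (a : Ax m n) : Px r →L[ℝ] ℝ :=
  if h : k < r + 1 then
    (ContinuousLinearMap.proj (R := ℝ) (φ := fun _ : Fin 3 => ℝ) (tyA m n a)).comp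
      (ContinuousLinearMap.proj (R := ℝ) (φ := fun _ : Fin (r+1) => Fin 3 → ℝ) ⟨k, h⟩)
  else 0

theorem KA_apply (r m n k : ℕ) (h : k < r + 1) (a : Ax m n) (c : Px r) :
    KA r m n k a c = c ⟨k, h⟩ (tyA m n a) := by
  simp [KA, h]

theorem KA_of_ge (r m n k : ℕ) (h : ¬ k < r + 1) (a : Ax m n) (c : Px r) :
    KA r m n k a c = 0 := by
  simp [KA, h]

/-- directions of the Gaussian fields -/
def eA {m n l : ℕ} (t : ℝ) (x : Fin l → Fin n → ℝ) (y : Fin l → Fin m → ℝ) : Ax m n → Ex l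
  | Sum.inl _ => fun i1 i2 => Real.sqrt t * nrm2 (x i1) * nrm2 (y i2)
  | Sum.inr (Sum.inl j) => fun i1 i2 => Real.sqrt (1 - t) * nrm2 (x i1) * y i2 j
  | Sum.inr (Sum.inr j) => fun i1 i2 => Real.sqrt (1 - t) * nrm2 (y i2) * x i1 j

theorem steinOne_xi (m n : ℕ) : SteinOne (muU m n) (xiA m n) := by
  refine ⟨fun a => match a with
    | Sum.inl _ => (1, 0)
    | Sum.inr (Sum.inl j) => (0, (Pi.single j 1, 0))
    | Sum.inr (Sum.inr j) => (0, (0, Pi.single j 1)), ?_, ?_, ?_⟩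
  · rintro (_ | j | j)
    · exact stein_stdG.prod_left expMom_stdG ((expMom_gVec m).prod (expMom_gVec n))
    · exact Stein.prod_right ((expMom_gVec m).prod (expMom_gVec n)) expMom_stdG
        ((stein_gVec j).prod_left (expMom_gVec m) (expMom_gVec n))
    · exact Stein.prod_right ((expMom_gVec m).prod (expMom_gVec n)) expMom_stdG
        (Stein.prod_right (expMom_gVec n) (expMom_gVec m) (stein_gVec j))
  · rintro (_ | j | j) (_ | i | i) h <;> simp_all [xiA]
  · rintro (_ | j | j) <;> simp [xiA]

/-- the matrix part of the field -/
def zGL {m n l : ℕ} (t : ℝ) (x : Fin l → Fin n → ℝ) (y : Fin l → Fin m → ℝ) :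
    (Fin m → Fin n → ℝ) →L[ℝ] Ex l :=
  ContinuousLinearMap.pi fun i1 => ContinuousLinearMap.pi fun i2 =>
    ∑ j, ∑ k, (Real.sqrt t * (y i2 j * x i1 k)) •
      (ContinuousLinearMap.proj (R := ℝ) (φ := fun _ : Fin n => ℝ) k).comp
        (ContinuousLinearMap.proj (R := ℝ) (φ := fun _ : Fin m => Fin n → ℝ) j)

theorem zGL_apply {m n l : ℕ} (t : ℝ) (x : Fin l → Fin n → ℝ) (y : Fin l → Fin m → ℝ)
    (G : Fin m → Fin n → ℝ) (i1 i2 : Fin l) :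
    zGL t x y G i1 i2 = Real.sqrt t * (∑ j, ∑ k, y i2 j * (G j k * x i1 k)) := by
  simp only [zGL, ContinuousLinearMap.pi_apply, sum_apply, smul_apply,
    ContinuousLinearMap.comp_apply, ContinuousLinearMap.proj_apply, smul_eq_mul, Finset.mul_sum]
  refine Finset.sum_congr rfl fun j _ => Finset.sum_congr rfl fun k _ => by ring

/-- coefficients -/
def cv (r : ℕ) (p q : ℕ → ℝ) : Px r := fun k =>
  ![Real.sqrt (p (k : ℕ) * q (k : ℕ) - p ((k : ℕ) + 1) * q ((k : ℕ) + 1)),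
    Real.sqrt (p (k : ℕ) - p ((k : ℕ) + 1)), Real.sqrt (q (k : ℕ) - q ((k : ℕ) + 1))]

/-- one level shift -/
def sh {m n l : ℕ} (r : ℕ) (t : ℝ) (x : Fin l → Fin n → ℝ) (y : Fin l → Fin m → ℝ) (c : Px r)
    (k : ℕ) (u : Us m n) : Ex l := shift (KA r m n k) (xiA m n) (eA t x y) c u

/-- remaining levels -/
def Wt {m n l : ℕ} (r : ℕ) (t : ℝ) (x : Fin l → Fin n → ℝ) (y : Fin l → Fin m → ℝ) (c : Px r)
    (k : ℕ) (U : Fin (r+1) → Us m n) : Ex l :=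
  ∑ j : Fin (r+1), if k ≤ (j:ℕ) then sh r t x y c j (U j) else 0

theorem Wt_update {m n l : ℕ} (r : ℕ) (t : ℝ) (x : Fin l → Fin n → ℝ) (y : Fin l → Fin m → ℝ)
    (c : Px r) (k : ℕ) (h : k < r + 1) (U : Fin (r+1) → Us m n) (u : Us m n) :
    Wt r t x y c k (Function.update U ⟨k, h⟩ u) = Wt r t x y c (k+1) U + sh r t x y c k u := by
  unfold Wt
  rw [← Finset.add_sum_erase _ _ (Finset.mem_univ (⟨k, h⟩ : Fin (r+1))),
    ← Finset.add_sum_erase Finset.univ (fun j : Fin (r+1) =>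
      if k + 1 ≤ (j:ℕ) then sh r t x y c j (U j) else 0) (Finset.mem_univ (⟨k, h⟩ : Fin (r+1)))]
  simp only [le_refl, if_true, Function.update_self]
  rw [if_neg (by omega), zero_add, add_comm]
  congr 1
  refine Finset.sum_congr rfl fun j hj => ?_
  have hne := (Finset.mem_erase.1 hj).1
  rw [Function.update_of_ne hne]
  have : (j:ℕ) ≠ k := fun h' => hne (Fin.ext h')
  by_cases hk : k ≤ (j:ℕ)
  · rw [if_pos hk, if_pos (by omega)]
  · rw [if_neg hk, if_neg (by omega)]

theorem Wt_last {m n l : ℕ} (r : ℕ) (t : ℝ) (x : Fin l → Fin n → ℝ) (y : Fin l → Fin m → ℝ)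
    (c : Px r) (U : Fin (r+1) → Us m n) :
    Wt r t x y c r U = sh r t x y c r (U (Fin.last r)) := by
  unfold Wt
  rw [Finset.sum_eq_single (Fin.last r)]
  · simp
  · intro j _ hj
    rw [if_neg]
    intro h
    exact hj (Fin.ext (by have := j.2; simp; omega))
  · simp

theorem sh_apply {m n l : ℕ} (r : ℕ) (t : ℝ) (x : Fin l → Fin n → ℝ) (y : Fin l → Fin m → ℝ)
    (p q : ℕ → ℝ) (k : Fin (r+1)) (u : Us m n) (i1 i2 : Fin l) :
    sh r t x y (cv r p q) k u i1 i2 =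
      Real.sqrt (p (k : ℕ) * q (k : ℕ) - p ((k : ℕ) + 1) * q ((k : ℕ) + 1)) * u.1 *
        (Real.sqrt t * nrm2 (x i1) * nrm2 (y i2))
      + (∑ j, Real.sqrt (p (k : ℕ) - p ((k : ℕ) + 1)) * u.2.1 j *
          (Real.sqrt (1 - t) * nrm2 (x i1) * y i2 j))
      + ∑ j, Real.sqrt (q (k : ℕ) - q ((k : ℕ) + 1)) * u.2.2 j *
          (Real.sqrt (1 - t) * nrm2 (y i2) * x i1 j) := by
  unfold sh shift
  simp only [KA_apply r m n k k.2, Fintype.sum_sum_type, Finset.sum_apply,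
    Pi.smul_apply, smul_eq_mul, Finset.univ_unique, Finset.sum_singleton]
  simp [tyA, xiA, eA, cv, add_assoc]

theorem D0R_eq {m n l : ℕ} (r : ℕ) (β s t : ℝ) (mv p q : ℕ → ℝ) (x : Fin l → Fin n → ℝ)
    (y : Fin l → Fin m → ℝ) (G : Fin m → Fin n → ℝ) (U : Fin (r+1) → Us m n) (i1 i2 : Fin l) :
    D0R r 1 β s t mv p q x y G U i1 i2 =
      (zGL t x y G + Wt r t x y (cv r p q) 0 U) i1 i2 := by
  have h1 : Wt r t x y (cv r p q) 0 U i1 i2 =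
      ∑ k : Fin (r+1), sh r t x y (cv r p q) k (U k) i1 i2 := by
    simp [Wt, Finset.sum_apply]
  rw [Pi.add_apply, Pi.add_apply, zGL_apply, h1]
  simp only [sh_apply, Finset.sum_add_distrib]
  unfold D0R
  rw [one_mul]
  rw [Finset.sum_comm (s := Finset.univ (α := Fin (r+1)))]
  rw [Finset.sum_comm (s := Finset.univ (α := Fin (r+1))) (t := Finset.univ (α := Fin n))]
  have e1 : Real.sqrt (1 - t) * nrm2 (x i1) * (∑ j, y i2 j * (∑ k : Fin (r+1),
      Real.sqrt (p (k : ℕ) - p ((k : ℕ) + 1)) * (U k).2.1 j)) =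
      ∑ j, ∑ k : Fin (r+1), Real.sqrt (p (k : ℕ) - p ((k : ℕ) + 1)) * (U k).2.1 j *
          (Real.sqrt (1 - t) * nrm2 (x i1) * y i2 j) := by
    simp only [Finset.mul_sum]
    refine Finset.sum_congr rfl fun j _ => Finset.sum_congr rfl fun k _ => by ring
  have e2 : Real.sqrt t * nrm2 (x i1) * nrm2 (y i2) * (∑ k : Fin (r+1),
          Real.sqrt (p (k : ℕ) * q (k : ℕ) - p ((k : ℕ) + 1) * q ((k : ℕ) + 1)) * (U k).1) =
      ∑ k : Fin (r+1), Real.sqrt (p (k : ℕ) * q (k : ℕ) - p ((k : ℕ) + 1) * q ((k : ℕ) + 1)) *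
        (U k).1 * (Real.sqrt t * nrm2 (x i1) * nrm2 (y i2)) := by
    simp only [Finset.mul_sum]
    refine Finset.sum_congr rfl fun j _ => by ring
  have e3 : Real.sqrt (1 - t) * nrm2 (y i2) *
        (∑ kk, (∑ k : Fin (r+1), Real.sqrt (q (k : ℕ) - q ((k : ℕ) + 1)) * (U k).2.2 kk) * x i1 kk)
      = ∑ j, ∑ k : Fin (r+1), Real.sqrt (q (k : ℕ) - q ((k : ℕ) + 1)) * (U k).2.2 j *
          (Real.sqrt (1 - t) * nrm2 (y i2) * x i1 j) := by
    simp only [Finset.mul_sum, Finset.sum_mul]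
    refine Finset.sum_congr rfl fun j _ => Finset.sum_congr rfl fun k _ => by ring
  rw [e1, e2, e3]
  ring

/-- base partition function -/
def z0x {r l : ℕ} (β s : ℝ) (q : Px r × Ex l) : ℝ := ∑ i1, (∑ i2, exp (β * q.2 i1 i2)) ^ s

/-- base Gibbs weight -/
def g0x {r l : ℕ} (β s : ℝ) (i : Fin l × Fin l) (q : Px r × Ex l) : ℝ :=
  (∑ i2, exp (β * q.2 i.1 i2)) ^ s / z0x β s q *
    (exp (β * q.2 i.1 i.2) / ∑ i2, exp (β * q.2 i.1 i2))

theorem pg_exp {r l : ℕ} (N : ℕ) (β : ℝ) (i1 i2 : Fin l) :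
    PG N (fun q : Px r × Ex l => exp (β * q.2 i1 i2)) := by
  have h1 : ∀ b : ℝ, CG N (fun q : Px r × Ex l => exp (b * q.2 i1 i2)) := fun b =>
    CG.exp_clm N (b • (ContinuousLinearMap.proj (R := ℝ) (φ := fun _ : Fin l => ℝ) i2).comp
        (ContinuousLinearMap.proj (R := ℝ) (φ := fun _ : Fin l => Fin l → ℝ) i1))
  refine ⟨fun q => Real.exp_pos _, h1 β, ?_⟩
  refine (h1 (-β)).eg.mono fun q => ?_
  rw [← Real.exp_neg, neg_mul]

theorem pg_C {r l : ℕ} (N : ℕ) (β : ℝ) (hl : 1 ≤ l) (i1 : Fin l) :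
    PG N (fun q : Px r × Ex l => ∑ i2, exp (β * q.2 i1 i2)) := by
  have : Nonempty (Fin l) := ⟨⟨0, hl⟩⟩
  exact PG.sum fun i2 => pg_exp N β i1 i2

theorem pg_z0 {r l : ℕ} (N : ℕ) (β s : ℝ) (hl : 1 ≤ l) :
    PG N (z0x (r := r) (l := l) β s) := by
  have : Nonempty (Fin l) := ⟨⟨0, hl⟩⟩
  exact PG.sum fun i1 => (pg_C N β hl i1).rpow' s

theorem cg_g0 {r l : ℕ} (β s : ℝ) (hl : 1 ≤ l) (i : Fin l × Fin l) :
    CG 0 (g0x (r := r) β s i) := by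
  have h1 := (pg_C (r := r) 0 β hl i.1).rpow s
  have h2 := (pg_z0 (r := r) (l := l) 0 β s hl).inv'
  have h3 := (pg_exp (r := r) 0 β i.1 i.2).cg
  have h4 := (pg_C (r := r) 0 β hl i.1).inv'
  exact (h1.mul h2).mul (h3.mul h4)

theorem dd_z0 {r l : ℕ} (β s : ℝ) (hl : 1 ≤ l) (δ : Px r) (b : Ex l) (q : Px r × Ex l) :
    dd (δ, b) (z0x β s) q = ∑ i1, s * (∑ i2, exp (β * q.2 i1 i2)) ^ (s - 1) *
      ∑ i2, exp (β * q.2 i1 i2) * (β * b i1 i2) := by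
  have h1 : ∀ i1 i2, HasFDerivAt (fun q : Px r × Ex l => q.2 i1 i2)
      (((ContinuousLinearMap.proj (R := ℝ) (φ := fun _ : Fin l => ℝ) i2).comp
        (ContinuousLinearMap.proj (R := ℝ) (φ := fun _ : Fin l => Fin l → ℝ) i1)).comp
        (ContinuousLinearMap.snd ℝ (Px r) (Ex l))) q := fun i1 i2 =>
    (((ContinuousLinearMap.proj (R := ℝ) (φ := fun _ : Fin l => ℝ) i2).comp
        (ContinuousLinearMap.proj (R := ℝ) (φ := fun _ : Fin l => Fin l → ℝ) i1)).comp
        (ContinuousLinearMap.snd ℝ (Px r) (Ex l))).hasFDerivAt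
  have h2 : ∀ i1, HasFDerivAt (fun q : Px r × Ex l => ∑ i2, exp (β * q.2 i1 i2)) _ q := fun i1 =>
    HasFDerivAt.fun_sum fun i2 _ => ((h1 i1 i2).const_mul β).exp
  have h3 := HasFDerivAt.fun_sum (u := Finset.univ) fun i1 _ =>
    (h2 i1).rpow_const (p := s) (Or.inl ((pg_C 0 β hl i1).pos q).ne')
  have h4 : fderiv ℝ (z0x β s) q = _ := h3.fderiv
  unfold dd
  rw [h4]
  simp [sum_apply]

/-- basis vector -/
def bE {l : ℕ} (i : Fin l × Fin l) : Ex l := Pi.single i.1 (Pi.single i.2 1)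

theorem dd_z0_b {r l : ℕ} (β s : ℝ) (hl : 1 ≤ l) (i : Fin l × Fin l) :
    dd ((0 : Px r), bE i) (z0x β s) = fun q => (s * β) * z0x β s q * g0x β s i q := by
  ext q
  rw [dd_z0 β s hl]
  have hz := (pg_z0 0 β s hl).pos q
  have hC := (pg_C 0 β hl i.1).pos q
  have e1 : ∑ i2, exp (β * q.2 i.1 i2) * (β * bE i i.1 i2) = exp (β * q.2 i.1 i.2) * β := by
    rw [Finset.sum_eq_single i.2]
    · simp [bE]
    · intro j _ hj
      simp [bE, hj]
    · simp
  rw [Finset.sum_eq_single i.1, e1]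
  · unfold g0x
    rw [Real.rpow_sub_one hC.ne']
    field_simp
  · intro j _ hj
    simp [bE, hj]
  · simp

theorem dd_z0_δ {r l : ℕ} (β s : ℝ) (hl : 1 ≤ l) (δ : Px r) :
    dd (δ, (0 : Ex l)) (z0x β s) = 0 := by
  ext q
  rw [dd_z0 β s hl]
  simp

end concrete

end part5

section part6
section link

theorem int_CG_lin {P E Y : Type} [NormedAddCommGroup P] [NormedSpace ℝ P]
    [NormedAddCommGroup E] [NormedSpace ℝ E]
    [NormedAddCommGroup Y] [NormedSpace ℝ Y] [MeasurableSpace Y] [BorelSpace Y]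
    [SecondCountableTopology Y] {ν : Measure Y} (hν : ExpMom ν) {H : P × E → ℝ} (hH : CG 0 H)
    (L : Y →L[ℝ] E) (c : P) : Integrable (fun w => H (c, L w)) ν := by
  refine int_of_bd hν (hH.cont.comp (by fun_prop)) ?_
  obtain ⟨K, hK, h⟩ := hH.eg ‖c‖
  refine ⟨K * (1 + ‖L‖), by positivity, fun u => (h (c, L u) le_rfl).trans ?_⟩
  apply Real.exp_le_exp.2
  rw [mul_assoc]
  apply mul_le_mul_of_nonneg_left _ hK
  have h1 := L.le_opNorm u
  have h2 := norm_nonneg u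
  have h3 := norm_nonneg L
  simp only
  nlinarith

theorem deriv_G {P E Y : Type} [NormedAddCommGroup P] [NormedSpace ℝ P]
    [NormedAddCommGroup E] [NormedSpace ℝ E]
    [NormedAddCommGroup Y] [NormedSpace ℝ Y] [MeasurableSpace Y] [BorelSpace Y]
    [SecondCountableTopology Y] {ν : Measure Y} [IsProbabilityMeasure ν] (hν : ExpMom ν)
    {H : P × E → ℝ} (hH : CG 1 H)
    (L : Y →L[ℝ] E) (cr : ℝ → P) (δ : P) (ρ : ℝ) (hc : HasDerivAt cr δ ρ) :
    HasDerivAt (fun ρ => ∫ G, H (cr ρ, L G) ∂ν) (∫ G, dd (δ, 0) H (cr ρ, L G) ∂ν) ρ := by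
  let T : P × (E × Y) →L[ℝ] P × E := (ContinuousLinearMap.fst ℝ P (E × Y)).prod
    ((ContinuousLinearMap.fst ℝ E Y + L.comp (ContinuousLinearMap.snd ℝ E Y)).comp
      (ContinuousLinearMap.snd ℝ P (E × Y)))
  have hT : ∀ w, T w = (w.1, w.2.1 + L w.2.2) := fun w => rfl
  have hk : CG 1 (fun w => H (T w)) := by
    refine CG.comp (CG.clm 1 T) ?_ hH
    intro R
    refine ⟨R, 1 + ‖L‖, by positivity, fun w hw => ⟨hw, ?_⟩⟩
    rw [hT]
    simp only
    have h1 : ‖w.2.1‖ ≤ ‖w.2‖ := norm_fst_le w.2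
    have h2 : ‖w.2.2‖ ≤ ‖w.2‖ := norm_snd_le w.2
    have h3 := L.le_opNorm w.2.2
    have h4 := norm_add_le w.2.1 (L w.2.2)
    have h5 := norm_nonneg L
    have h6 := norm_nonneg w.2
    nlinarith
  have h1 := hasFDerivAt_avg ν hν hk (cr ρ, 0)
  have h2 : HasDerivAt (fun ρ => (cr ρ, (0 : E))) (δ, 0) ρ := hc.prodMk (hasDerivAt_const ρ 0)
  have h3 := HasFDerivAt.comp_hasDerivAt ρ h1 h2
  rw [ContinuousLinearMap.integral_apply] at h3
  · have e1 : (fun ρ => ∫ G, H (cr ρ, L G) ∂ν) =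
        (fun q : P × E => ∫ u, H (T (q.1, (q.2, u))) ∂ν) ∘ fun ρ => (cr ρ, (0 : E)) := by
      ext ρ
      simp [hT]
    have e2 : ∀ G, dd (δ, 0) H (cr ρ, L G) =
        ((fderiv ℝ (fun w => H (T w)) (cr ρ, ((0 : E), G))).comp iotaL) (δ, 0) := by
      intro G
      have h4 : HasFDerivAt (fun w => H (T w)) _ (cr ρ, ((0 : E), G)) :=
        (hH.2.1 (T (cr ρ, ((0 : E), G)))).hasFDerivAt.comp (cr ρ, ((0 : E), G)) T.hasFDerivAt
      rw [h4.fderiv]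
      have h5 : iotaL (X := Y) (δ, (0 : E)) = (δ, (0, 0)) := rfl
      simp only [ContinuousLinearMap.comp_apply, h5, hT]
      simp [dd]
    simp only [e2]
    rw [e1]
    exact h3
  · have hk' : CG 0 (fun w => (fderiv ℝ (fun w => H (T w)) w).comp
        (iotaL (P := P) (Z := E) (X := Y))) :=
      CG.clm_comp ((ContinuousLinearMap.compL ℝ (P × E) (P × (E × Y)) ℝ).flip iotaL) hk.2.2
    exact EG.integrable ν hν hk'.cont hk'.eg (cr ρ, 0)

theorem int_last (r m n : ℕ) (F : (Fin m → Fin n → ℝ) × Us m n → ℝ)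
    (hF : Integrable F ((gMat m n).prod (muU m n))) :
    ∫ ω, F (ω.1, ω.2 (Fin.last r)) ∂ muAll r m n = ∫ G, ∫ u, F (G, u) ∂ muU m n ∂ gMat m n := by
  have hmp : MeasurePreserving (Prod.map id (Function.eval (Fin.last r)))
      (muAll r m n) ((gMat m n).prod (muU m n)) :=
    (MeasurePreserving.id (gMat m n)).prod
      (measurePreserving_eval (fun _ : Fin (r+1) => muU m n) (Fin.last r))
  rw [← integral_prod _ hF]
  have hF' := hF.aestronglyMeasurable
  rw [← hmp.map_eq] at hF' ⊢
  rw [integral_map hmp.aemeasurable hF']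
  rfl

variable {m n l : ℕ} (r : ℕ) (β s t : ℝ) (mv : ℕ → ℝ) (x : Fin l → Fin n → ℝ)
    (y : Fin l → Fin m → ℝ)

/-- concrete `ζ` -/
abbrev ZZ (k : ℕ) : Px r × Ex l → ℝ :=
  Zt (muU m n) (KA r m n) (xiA m n) (eA t x y) mv (z0x β s) k

/-- concrete `Φ` -/
abbrev PP (lo hi : ℕ) (f : Px r × Ex l → ℝ) : Px r × Ex l → ℝ :=
  PhUp (muU m n) (KA r m n) (xiA m n) (eA t x y) mv (z0x β s) lo hi f

/-- concrete last average -/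
abbrev AA (f : Px r × Ex l → ℝ) : Px r × Ex l → ℝ :=
  Av (muU m n) (KA r m n r) (xiA m n) (eA t x y) f

/-- linear map of all remaining Gaussians -/
theorem lin_last (c : Px r) : ∃ L : (Fin m → Fin n → ℝ) × Us m n →L[ℝ] Ex l,
    ∀ w, L w = zGL t x y w.1 + sh r t x y c r w.2 := by
  refine ⟨(zGL t x y).comp (ContinuousLinearMap.fst ℝ _ _) +
    (∑ b, (KA r m n r b c) • (xiA m n b).smulRight (eA t x y b)).comp
      (ContinuousLinearMap.snd ℝ _ _), fun w => ?_⟩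
  simp [sh, shift, smul_smul, sum_apply]

theorem int_H {H : Px r × Ex l → ℝ} (hH : CG 0 H) (c : Px r) :
    Integrable (fun w : (Fin m → Fin n → ℝ) × Us m n =>
      H (c, zGL t x y w.1 + sh r t x y c r w.2)) ((gMat m n).prod (muU m n)) := by
  obtain ⟨L, hL⟩ := lin_last (m := m) (n := n) r t x y c
  have := int_CG_lin ((expMom_gMat m n).prod (expMom_muU m n)) hH L c
  simpa only [hL] using this

theorem int_muAll {H : Px r × Ex l → ℝ} (hH : CG 0 H) (c : Px r) :
    ∫ ω, H (c, zGL t x y ω.1 + Wt r t x y c r ω.2) ∂ muAll r m n =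
      ∫ G, AA r t x y H (c, zGL t x y G) ∂ gMat m n := by
  simp only [Wt_last]
  exact int_last r m n (fun w => H (c, zGL t x y w.1 + sh r t x y c r w.2)) (int_H r t x y hH c)

variable (p q : ℕ → ℝ)

theorem zetaR_eq (k : ℕ) (hk : k ≤ r) (G : Fin m → Fin n → ℝ) : ∀ U : Fin (r+1) → Us m n,
    zetaR r 1 β s t mv p q x y G k U =
      ZZ r β s t mv x y k (cv r p q, zGL t x y G + Wt r t x y (cv r p q) k U) := by
  induction k with
  | zero =>
    intro U
    simp only [zetaR, ZR, CR, AR, D0R_eq]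
    rfl
  | succ k ih =>
    intro U
    have h : k < r + 1 := by omega
    rw [zetaR, dif_pos h]
    simp only [ih (by omega), Wt_update, ← add_assoc]
    rfl

theorem PhiR_eq (k : ℕ) (hk : k + 1 ≤ r)
    (f : (Fin m → Fin n → ℝ) → (Fin (r+1) → Us m n) → ℝ) (fh : Px r × Ex l → ℝ)
    (hf : ∀ G U, f G U = fh (cv r p q, zGL t x y G + Wt r t x y (cv r p q) k U))
    (G : Fin m → Fin n → ℝ) (U : Fin (r+1) → Us m n) :
    PhiR r 1 β s t mv p q x y (k+1) f G U =
      Ph (muU m n) (KA r m n) (xiA m n) (eA t x y) mv (z0x β s) k fh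
        (cv r p q, zGL t x y G + Wt r t x y (cv r p q) (k+1) U) := by
  have h : k < r + 1 := by omega
  unfold PhiR
  simp only [Nat.add_sub_cancel]
  rw [dif_pos h]
  simp only [hf, zetaR_eq r β s t mv x y p q k (by omega),
    zetaR_eq r β s t mv x y p q (k+1) hk, Wt_update, ← add_assoc]
  rfl

theorem PhiUpToR_eq (k0 : ℕ)
    (f : (Fin m → Fin n → ℝ) → (Fin (r+1) → Us m n) → ℝ) (fh : Px r × Ex l → ℝ)
    (hf : ∀ G U, f G U = fh (cv r p q, zGL t x y G + Wt r t x y (cv r p q) k0 U))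
    (hi : ℕ) (hk : k0 ≤ hi) : hi ≤ r → ∀ (G : Fin m → Fin n → ℝ) (U : Fin (r+1) → Us m n),
    PhiUpToR r 1 β s t mv p q x y (k0+1) hi f G U =
      PP r β s t mv x y (k0+1) hi fh
        (cv r p q, zGL t x y G + Wt r t x y (cv r p q) hi U) := by
  induction hi, hk using Nat.le_induction with
  | base =>
    intro _ G U
    rw [PP, PhUp_of_lt _ _ _ _ _ _ (by omega), ← hf]
    cases k0 with
    | zero => rfl
    | succ k => simp [PhiUpToR]
  | succ k hk ih =>
    intro hr G U
    rw [PP, PhUp_succ _ _ _ _ _ _ (by omega), PhiUpToR, if_neg (by omega)]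
    exact PhiR_eq r β s t mv x y p q k hr _ _ (ih (by omega)) G U

theorem gam0R_eq (i1 i2 : Fin l) (G : Fin m → Fin n → ℝ) (U : Fin (r+1) → Us m n) :
    gam0R r 1 β s t mv p q x y i1 i2 G U =
      g0x β s (i1, i2) (cv r p q, zGL t x y G + Wt r t x y (cv r p q) 0 U) := by
  simp only [gam0R, g0x, z0x, ZR, CR, AR, D0R_eq]

/-- concrete Gibbs averages -/
abbrev gh (k : ℕ) (i : Fin l × Fin l) : Px r × Ex l → ℝ :=
  PP r β s t mv x y 1 k (g0x β s i)

theorem gamR_eq (k1 : ℕ) (hk : k1 ≤ r) (i1 i2 p1 p2 : Fin l) (G : Fin m → Fin n → ℝ)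
    (U : Fin (r+1) → Us m n) :
    gamR r 1 β s t mv p q x y k1 i1 i2 p1 p2 G U =
      PP r β s t mv x y (k1+1) r (fun w => gh r β s t mv x y k1 (i1, i2) w *
          gh r β s t mv x y k1 (p1, p2) w)
        (cv r p q, zGL t x y G + Wt r t x y (cv r p q) r U) := by
  unfold gamR
  refine PhiUpToR_eq r β s t mv x y p q k1 _ _ (fun G U => ?_) r hk le_rfl G U
  have h := fun i1 i2 => PhiUpToR_eq r β s t mv x y p q 0 _ _
    (gam0R_eq r β s t mv x y p q i1 i2) k1 (Nat.zero_le _) hk G U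
  simp only [zero_add] at h
  rw [h, h]

theorem cg_gh (hl : 1 ≤ l) (k : ℕ) (i : Fin l × Fin l) : CG 0 (gh r β s t mv x y k i) :=
  CG.PhUp (muU m n) (expMom_muU m n) _ _ _ _ (pg_z0 2 β s hl) 1 k (cg_g0 β s hl i)

/-- two-replica expectations -/
def JJ (c : Px r) (k1 : ℕ) (w : (Fin l × Fin l) × (Fin l × Fin l)) : ℝ :=
  ∫ G, AA r t x y (PP r β s t mv x y (k1+1) r (fun q => gh r β s t mv x y k1 w.1 q *
          gh r β s t mv x y k1 w.2 q)) (c, zGL t x y G) ∂ gMat m n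

theorem cg_pair (hl : 1 ≤ l) (k1 : ℕ) (w : (Fin l × Fin l) × (Fin l × Fin l)) :
    CG 0 (PP r β s t mv x y (k1+1) r (fun q => gh r β s t mv x y k1 w.1 q *
          gh r β s t mv x y k1 w.2 q)) :=
  CG.PhUp (muU m n) (expMom_muU m n) _ _ _ _ (pg_z0 2 β s hl) (k1+1) r
    ((cg_gh r β s t mv x y hl k1 w.1).mul (cg_gh r β s t mv x y hl k1 w.2))

theorem int_sum_JJ (hl : 1 ≤ l) (c : Px r) (k1 : ℕ)
    (f : (Fin l × Fin l) × (Fin l × Fin l) → ℝ) :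
    ∫ ω, (∑ w, f w * PP r β s t mv x y (k1+1) r (fun q => gh r β s t mv x y k1 w.1 q *
          gh r β s t mv x y k1 w.2 q) (c, zGL t x y ω.1 + Wt r t x y c r ω.2)) ∂ muAll r m n =
      ∑ w, f w * JJ r β s t mv x y c k1 w := by
  rw [int_muAll r t x y (H := fun q' => ∑ w, f w * PP r β s t mv x y (k1+1) r
    (fun q => gh r β s t mv x y k1 w.1 q * gh r β s t mv x y k1 w.2 q) q')
    (CG.sum _ fun w _ => (cg_pair r β s t mv x y hl k1 w).const_mul (f w)) c]
  have hA : ∀ G, AA r t x y (fun q' => ∑ w, f w * PP r β s t mv x y (k1+1) r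
    (fun q => gh r β s t mv x y k1 w.1 q * gh r β s t mv x y k1 w.2 q) q') (c, zGL t x y G) =
    ∑ w, f w * AA r t x y (PP r β s t mv x y (k1+1) r
    (fun q => gh r β s t mv x y k1 w.1 q * gh r β s t mv x y k1 w.2 q)) (c, zGL t x y G) := by
    intro G
    unfold AA Av
    rw [integral_finsetSum]
    · simp only [integral_const_mul]
    · intro w _
      exact (Av_integrable (muU m n) (expMom_muU m n) (KA r m n r) (xiA m n) (eA t x y)
        (cg_pair r β s t mv x y hl k1 w) (c, zGL t x y G)).const_mul _
  simp only [hA]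
  rw [integral_finsetSum]
  · simp only [integral_const_mul]
    rfl
  · intro w _
    refine Integrable.const_mul ?_ _
    exact int_CG_lin (expMom_gMat m n) (CG.Av (muU m n) (expMom_muU m n) (KA r m n r) (xiA m n)
      (eA t x y) (cg_pair r β s t mv x y hl k1 w)) (zGL t x y) c

theorem EBrR_eq (hl : 1 ≤ l) (k1 : ℕ) (hk : k1 ≤ r) (f : Fin l → Fin l → Fin l → Fin l → ℝ) :
    EBrR r 1 β s t mv p q x y k1 f = ∑ w : (Fin l × Fin l) × (Fin l × Fin l),
      f w.1.1 w.1.2 w.2.1 w.2.2 * JJ r β s t mv x y (cv r p q) k1 w := by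
  rw [← int_sum_JJ r β s t mv x y hl (cv r p q) k1
    (fun w => f w.1.1 w.1.2 w.2.1 w.2.2)]
  unfold EBrR
  simp only [gamR_eq r β s t mv x y p q k1 hk, Fintype.sum_prod_type]

theorem psiR_eq (hl : 1 ≤ l) :
    psiR r 1 β s t mv p q x y = (β * |s| * Real.sqrt (n : ℝ) * mv r)⁻¹ *
      ∫ G, AA r t x y (fun w => Real.log (ZZ r β s t mv x y r w)) (cv r p q, zGL t x y G)
        ∂ gMat m n := by
  unfold psiR
  simp only [zetaR_eq r β s t mv x y p q r le_rfl]
  rw [integral_const_mul]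
  congr 1
  exact int_muAll r t x y (PG.Zt (muU m n) (expMom_muU m n) _ _ _ _ (pg_z0 2 β s hl) r).log.zero _

theorem eA_sum (e : Ex l) : e = ∑ i : Fin l × Fin l, e i.1 i.2 • bE i := by
  ext i1 i2
  rw [Finset.sum_apply, Finset.sum_apply, Finset.sum_eq_single (i1, i2)]
  · simp [bE]
  · rintro ⟨j1, j2⟩ _ hj
    by_cases h1 : j1 = i1
    · subst h1
      have : j2 ≠ i2 := fun h => hj (by rw [h])
      simp [bE, this.symm]
    · simp [bE, Ne.symm h1]
  · simp

/-- The source term in terms of Gibbs averages. -/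
theorem Fst_eq (hl : 1 ≤ l) (hm0 : mv 0 = 1) (hm : ∀ k ≤ r, 0 < mv k) (c δ : Px r) (k : ℕ)
    (hk : k + 1 ≤ r) :
    Fst (muU m n) (KA r m n) (xiA m n) (eA t x y) mv (z0 := z0x β s) c δ k =
    fun q' => ∑ w : (Fin l × Fin l) × (Fin l × Fin l),
      ((mv (k+2) - mv (k+1)) * (s * β) ^ 2 * ∑ a, KA r m n (k+1) a c * KA r m n (k+1) a δ *
        (eA t x y a w.1.1 w.1.2 * eA t x y a w.2.1 w.2.2)) *
      (gh r β s t mv x y (k+1) w.1 q' * gh r β s t mv x y (k+1) w.2 q') := by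
  ext q'
  have hZ := PG.Zt (muU m n) (expMom_muU m n) (KA r m n) (xiA m n) (eA t x y) mv
    (pg_z0 (r := r) 2 β s hl) (k+1)
  have hp := hZ.pos q'
  have hmk := hm (k+1) hk
  have hd : ∀ a, dd (0, eA t x y a) (ZZ r β s t mv x y (k+1)) q' /
      (mv (k+1) * ZZ r β s t mv x y (k+1) q') =
      (s * β) * ∑ i : Fin l × Fin l, eA t x y a i.1 i.2 * gh r β s t mv x y (k+1) i q' := by
    intro a
    have e1 : dd (0, eA t x y a) (ZZ r β s t mv x y (k+1)) q' =
        ∑ i : Fin l × Fin l, eA t x y a i.1 i.2 *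
          dd (0, bE i) (ZZ r β s t mv x y (k+1)) q' := by
      unfold dd
      have e2 : ((0 : Px r), eA t x y a) =
          ∑ i : Fin l × Fin l, eA t x y a i.1 i.2 • ((0 : Px r), bE i) := by
        ext1
        · simp [Prod.fst_sum]
        · rw [Prod.snd_sum]
          simp only [Prod.smul_snd]
          exact eA_sum _
      rw [e2, map_sum]
      simp only [map_smul, smul_eq_mul]
    rw [e1]
    simp only [ZZ]
    simp only [fun i => dd_Zt_z (muU m n) (expMom_muU m n) (KA r m n) (xiA m n) (eA t x y) mv
      (pg_z0 (r := r) 2 β s hl) r hm0 hm (bE i) (s * β) (g0x β s i) (dd_z0_b β s hl i) (k+1) hk]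
    rw [Finset.sum_div, Finset.mul_sum]
    refine Finset.sum_congr rfl fun i _ => ?_
    field_simp
  unfold Fst
  simp only [ZZ] at hd
  simp only [hd]
  have hsq : ∀ A : Fin l × Fin l → ℝ, (∑ i, A i) ^ 2 =
      ∑ w : (Fin l × Fin l) × (Fin l × Fin l), A w.1 * A w.2 := by
    intro A
    rw [sq, Finset.sum_mul_sum, Fintype.sum_prod_type (f := fun w => A w.1 * A w.2)]
  simp only [mul_pow (s * β), hsq]
  simp only [Finset.mul_sum, Finset.sum_mul]
  rw [Finset.sum_comm]
  refine Finset.sum_congr rfl fun w _ => Finset.sum_congr rfl fun a _ => by ring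

theorem int_Fst (hl : 1 ≤ l) (hm0 : mv 0 = 1) (hm : ∀ k ≤ r, 0 < mv k) (c δ : Px r) (k : ℕ)
    (hk : k + 1 ≤ r) :
    ∫ G, Av (muU m n) (KA r m n r) (xiA m n) (eA t x y)
      (PhUp (muU m n) (KA r m n) (xiA m n) (eA t x y) mv (z0x β s) (k+2) r
        (Fst (muU m n) (KA r m n) (xiA m n) (eA t x y) mv (z0 := z0x β s) c δ k))
        (c, zGL t x y G) ∂ gMat m n =
        ∑ w : (Fin l × Fin l) × (Fin l × Fin l),
        ((mv (k+2) - mv (k+1)) * (s * β) ^ 2 * ∑ a, KA r m n (k+1) a c *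
          KA r m n (k+1) a δ * (eA t x y a w.1.1 w.1.2 * eA t x y a w.2.1 w.2.2)) *
        JJ r β s t mv x y c (k+1) w := by
  rw [Fst_eq r β s t mv x y hl hm0 hm _ δ k hk]
  generalize hf : (fun w : (Fin l × Fin l) × (Fin l × Fin l) =>
    (mv (k+2) - mv (k+1)) * (s * β) ^ 2 * ∑ a, KA r m n (k+1) a c *
          KA r m n (k+1) a δ * (eA t x y a w.1.1 w.1.2 * eA t x y a w.2.1 w.2.2)) = f
  have hf' : ∀ w : (Fin l × Fin l) × (Fin l × Fin l),
    (mv (k+2) - mv (k+1)) * (s * β) ^ 2 * ∑ a, KA r m n (k+1) a c *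
          KA r m n (k+1) a δ * (eA t x y a w.1.1 w.1.2 * eA t x y a w.2.1 w.2.2) = f w :=
    fun w => congrFun hf w
  simp only [hf']
  have h0 := pg_z0 (r := r) (l := l) 2 β s hl
  have e3 := PhUp_sum (muU m n) (expMom_muU m n) (KA r m n) (xiA m n) (eA t x y) mv h0 (k+2) r
      Finset.univ f
      (f := fun w q => gh r β s t mv x y (k+1) w.1 q * gh r β s t mv x y (k+1) w.2 q)
      (fun w => (cg_gh r β s t mv x y hl (k+1) w.1).mul (cg_gh r β s t mv x y hl (k+1) w.2))
  rw [e3, ← int_sum_JJ r β s t mv x y hl c (k+1) f]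
  exact (int_muAll r t x y (H := fun q' => ∑ w, f w * PP r β s t mv x y ((k+1)+1) r
    (fun q => gh r β s t mv x y (k+1) w.1 q * gh r β s t mv x y (k+1) w.2 q) q')
    (CG.sum _ fun w _ => (cg_pair r β s t mv x y hl (k+1) w).const_mul (f w)) c).symm

/-- total derivative along a curve of coefficients -/
theorem psi_deriv (hl : 1 ≤ l) (hm0 : mv 0 = 1) (hm : ∀ k ≤ r, 0 < mv k) (hmr : mv (r+1) = 0)
    (pr qr : ℝ → ℕ → ℝ) (ρ : ℝ) (hp : pr ρ = p) (hq : qr ρ = q) (δ : Px r) (k : ℕ)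
    (hk : k + 1 ≤ r) (hc : HasDerivAt (fun ρ => cv r (pr ρ) (qr ρ)) δ ρ)
    (hlow : ∀ j < k, ∀ a, KA r m n j a δ = 0) (hhigh : ∀ j, k + 2 ≤ j → ∀ a, KA r m n j a δ = 0)
    (hK : ∀ a, KA r m n k a (cv r p q) * KA r m n k a δ =
      - (KA r m n (k+1) a (cv r p q) * KA r m n (k+1) a δ)) :
    HasDerivAt (fun ρ => psiR r 1 β s t mv (pr ρ) (qr ρ) x y)
      ((β * |s| * Real.sqrt (n : ℝ) * mv r)⁻¹ * (mv r *
        ∑ w : (Fin l × Fin l) × (Fin l × Fin l),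
        ((mv (k+2) - mv (k+1)) * (s * β) ^ 2 * ∑ a, KA r m n (k+1) a (cv r p q) *
          KA r m n (k+1) a δ * (eA t x y a w.1.1 w.1.2 * eA t x y a w.2.1 w.2.2)) *
        JJ r β s t mv x y (cv r p q) (k+1) w)) ρ := by
  subst hp hq
  simp only [psiR_eq r β s t mv x y _ _ hl]
  refine HasDerivAt.const_mul _ ?_
  have h0 := pg_z0 (r := r) (l := l) 2 β s hl
  have hZ := PG.Zt (muU m n) (expMom_muU m n) (KA r m n) (xiA m n) (eA t x y) mv h0 r
  have hH := (CG.Av (muU m n) (expMom_muU m n) (KA r m n r) (xiA m n) (eA t x y) hZ.log).pred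
  have h1 := deriv_G (expMom_gMat m n) hH (zGL t x y) (fun ρ => cv r (pr ρ) (qr ρ)) δ ρ hc
  refine h1.congr_deriv ?_
  have e2 : ∀ z, dd (δ, 0) (Av (muU m n) (KA r m n r) (xiA m n) (eA t x y)
      (fun q => Real.log (Zt (muU m n) (KA r m n) (xiA m n) (eA t x y) mv (z0x β s) r q)))
      (cv r (pr ρ) (qr ρ), z) = _ := fun z =>
    dd_final (muU m n) (expMom_muU m n) (KA r m n) (xiA m n) (eA t x y) mv
    (cv r (pr ρ) (qr ρ)) δ k (steinOne_xi m n) h0 (dd_z0_δ β s hl δ) hlow hhigh hK r hm hmr hk z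
  refine (integral_congr_ae (Filter.Eventually.of_forall fun G => e2 (zGL t x y G))).trans ?_
  rw [integral_const_mul]
  refine congrArg (fun z => mv r * z) ?_
  exact int_Fst r β s t mv x y hl hm0 hm _ δ k hk

end link

end part6

section fin
variable {m n l : ℕ} (r : ℕ) (β s t : ℝ) (mv : ℕ → ℝ) (x : Fin l → Fin n → ℝ) (y : Fin l → Fin m → ℝ)

theorem sum_eA (ht : t ∈ Set.Ioo (0:ℝ) 1) (B : Fin 3 → ℝ) (i1 i2 j1 j2 : Fin l) :
    ∑ a : Ax m n, B (tyA m n a) * (eA t x y a i1 i2 * eA t x y a j1 j2) =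
      B 0 * t * (nrm2 (x i1) * nrm2 (x j1) * nrm2 (y i2) * nrm2 (y j2))
      + B 1 * (1 - t) * (nrm2 (x i1) * nrm2 (x j1) * dotv (y j2) (y i2))
      + B 2 * (1 - t) * (nrm2 (y i2) * nrm2 (y j2) * dotv (x j1) (x i1)) := by
  have h1 : Real.sqrt t * Real.sqrt t = t := Real.mul_self_sqrt ht.1.le
  have h2 : Real.sqrt (1 - t) * Real.sqrt (1 - t) = 1 - t :=
    Real.mul_self_sqrt (by linarith [ht.2])
  have hA : ∑ a : Ax m n, B (tyA m n a) * (eA t x y a i1 i2 * eA t x y a j1 j2) =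
      B 0 * ((Real.sqrt t * nrm2 (x i1) * nrm2 (y i2)) * (Real.sqrt t * nrm2 (x j1) * nrm2 (y j2)))
      + ((∑ j : Fin m, B 1 * ((Real.sqrt (1 - t) * nrm2 (x i1) * y i2 j) *
          (Real.sqrt (1 - t) * nrm2 (x j1) * y j2 j)))
      + ∑ j : Fin n, B 2 * ((Real.sqrt (1 - t) * nrm2 (y i2) * x i1 j) *
          (Real.sqrt (1 - t) * nrm2 (y j2) * x j1 j))) := by
    unfold Ax
    rw [Fintype.sum_sum_type, Fintype.sum_sum_type]
    simp [tyA, eA]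
  rw [hA]
  have e1 : (∑ j : Fin m, B 1 * ((Real.sqrt (1 - t) * nrm2 (x i1) * y i2 j) *
          (Real.sqrt (1 - t) * nrm2 (x j1) * y j2 j))) =
      B 1 * (1 - t) * (nrm2 (x i1) * nrm2 (x j1) * dotv (y j2) (y i2)) := by
    unfold dotv
    rw [Finset.mul_sum, Finset.mul_sum]
    refine Finset.sum_congr rfl fun j _ => ?_
    linear_combination (B 1 * nrm2 (x i1) * nrm2 (x j1) * y i2 j * y j2 j) * h2
  have e2 : (∑ j : Fin n, B 2 * ((Real.sqrt (1 - t) * nrm2 (y i2) * x i1 j) *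
          (Real.sqrt (1 - t) * nrm2 (y j2) * x j1 j))) =
      B 2 * (1 - t) * (nrm2 (y i2) * nrm2 (y j2) * dotv (x j1) (x i1)) := by
    unfold dotv
    rw [Finset.mul_sum, Finset.mul_sum]
    refine Finset.sum_congr rfl fun j _ => ?_
    linear_combination (B 2 * nrm2 (y i2) * nrm2 (y j2) * x i1 j * x j1 j) * h2
  rw [e1, e2]
  linear_combination (B 0 * nrm2 (x i1) * nrm2 (x j1) * nrm2 (y i2) * nrm2 (y j2)) * h1

theorem psi_deriv2 (hn : 1 ≤ n) (hs : s ≠ 0) (hβ : 0 < β) (ht : t ∈ Set.Ioo (0:ℝ) 1)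
    (hl : 1 ≤ l) (hm0 : mv 0 = 1) (hm : ∀ k ≤ r, 0 < mv k)
    (hmr : mv (r+1) = 0) (p q : ℕ → ℝ)
    (pr qr : ℝ → ℕ → ℝ) (ρ : ℝ) (hp : pr ρ = p) (hq : qr ρ = q) (δ : Px r) (k : ℕ)
    (hk : k + 1 ≤ r) (hc : HasDerivAt (fun ρ => cv r (pr ρ) (qr ρ)) δ ρ)
    (h0 : ∀ j : Fin (r+1), (j : ℕ) ≠ k → (j : ℕ) ≠ k + 1 → δ j = 0)
    (B : Fin 3 → ℝ)
    (hB : ∀ i, cv r p q ⟨k+1, by omega⟩ i * δ ⟨k+1, by omega⟩ i = B i / 2)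
    (hB' : ∀ i, cv r p q ⟨k, by omega⟩ i * δ ⟨k, by omega⟩ i = - (B i / 2)) :
    HasDerivAt (fun ρ => psiR r 1 β s t mv (pr ρ) (qr ρ) x y)
      (Real.sign s * s * β / (2 * Real.sqrt (n : ℝ)) * ((mv (k+2) - mv (k+1)) *
        (B 0 * t * EXR r 1 β s t mv p q x y (k+1)
        + B 1 * (1 - t) * EBrR r 1 β s t mv p q x y (k+1) (fun i1 i2 pp1 pp2 =>
            nrm2 (x i1) * nrm2 (x pp1) * dotv (y pp2) (y i2))
        + B 2 * (1 - t) * EBrR r 1 β s t mv p q x y (k+1) (fun i1 i2 pp1 pp2 =>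
            nrm2 (y i2) * nrm2 (y pp2) * dotv (x pp1) (x i1))))) ρ := by
  have h1 := psi_deriv r β s t mv x y p q hl hm0 hm hmr pr qr ρ hp hq δ k hk hc
    (by
      intro j hj a
      rw [KA_apply r m n j (by omega), h0 ⟨j, by omega⟩ (by simp; omega) (by simp; omega)]; rfl)
    (by
      intro j hj a
      by_cases h : j < r + 1
      · rw [KA_apply r m n j h, h0 ⟨j, h⟩ (by simp; omega) (by simp; omega)]; rfl
      · exact KA_of_ge r m n j h a δ)
    (by
      intro a
      rw [KA_apply r m n k (by omega), KA_apply r m n k (by omega),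
        KA_apply r m n (k+1) (by omega), KA_apply r m n (k+1) (by omega), hB, hB'])
  refine h1.congr_deriv ?_
  have e1 : ∀ w : (Fin l × Fin l) × (Fin l × Fin l),
      (∑ a, KA r m n (k+1) a (cv r p q) *
          KA r m n (k+1) a δ * (eA t x y a w.1.1 w.1.2 * eA t x y a w.2.1 w.2.2)) =
      1 / 2 * (B 0 * t * (nrm2 (x w.1.1) * nrm2 (x w.2.1) * nrm2 (y w.1.2) * nrm2 (y w.2.2))
      + B 1 * (1 - t) * (nrm2 (x w.1.1) * nrm2 (x w.2.1) * dotv (y w.2.2) (y w.1.2))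
      + B 2 * (1 - t) * (nrm2 (y w.1.2) * nrm2 (y w.2.2) * dotv (x w.2.1) (x w.1.1))) := by
    intro w
    rw [← sum_eA t x y ht B, Finset.mul_sum]
    refine Finset.sum_congr rfl fun a _ => ?_
    rw [KA_apply r m n (k+1) (by omega), KA_apply r m n (k+1) (by omega), hB]
    ring
  simp only [e1]
  unfold EXR
  rw [EBrR_eq r β s t mv x y p q hl (k+1) hk, EBrR_eq r β s t mv x y p q hl (k+1) hk,
    EBrR_eq r β s t mv x y p q hl (k+1) hk]
  have hn' : 0 < Real.sqrt (n : ℝ) := Real.sqrt_pos.2 (by exact_mod_cast hn)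
  have hmrp := hm r le_rfl
  have hsg : Real.sign s * |s| = s := by
    rcases lt_or_gt_of_ne hs with h | h
    · rw [Real.sign_of_neg h, abs_of_neg h]; ring
    · rw [Real.sign_of_pos h, abs_of_pos h]; ring
  have hsa : 0 < |s| := abs_pos.2 hs
  have hcst : (β * |s| * Real.sqrt (n : ℝ) * mv r)⁻¹ * mv r * (s * β) ^ 2 * (1 / 2) =
      Real.sign s * s * β / (2 * Real.sqrt (n : ℝ)) := by
    field_simp
    rw [mul_comm |s|, hsg]
  rw [← hcst]
  simp only [Finset.mul_sum, ← Finset.sum_add_distrib]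
  refine Finset.sum_congr rfl fun w _ => ?_
  ring

theorem hasDerivAt_sqrt_half {f : ℝ → ℝ} {a ρ : ℝ} (h : HasDerivAt f a ρ) {v : ℝ} (hv : f ρ = v)
    (hp : 0 < v) : HasDerivAt (fun z => Real.sqrt (f z)) (a / (2 * Real.sqrt v)) ρ := by
  have := h.sqrt (by rw [hv]; exact hp.ne')
  rwa [hv] at this

theorem hasDerivAt_upd (p : ℕ → ℝ) (i j : ℕ) (ρ : ℝ) :
    HasDerivAt (fun z => Function.update p i z j) (if j = i then 1 else 0) ρ := by
  by_cases h : j = i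
  · subst h; simpa using hasDerivAt_id' ρ
  · simpa [h] using hasDerivAt_const ρ (p j)

theorem sqrt_half {v a : ℝ} (hv : 0 < v) : Real.sqrt v * (a / (2 * Real.sqrt v)) = a / 2 := by
  have := Real.sqrt_pos.2 hv
  field_simp

/-- indicator -/
def dI (i j : ℕ) : ℝ := if j = i then 1 else 0

/-- derivative of the coefficients in the variable `p i` -/
def dlp (r : ℕ) (p q : ℕ → ℝ) (i : ℕ) : Px r := fun k =>
  ![(dI i k * q k - dI i (k+1) * q (k+1)) /
      (2 * Real.sqrt (p (k : ℕ) * q (k : ℕ) - p ((k : ℕ) + 1) * q ((k : ℕ) + 1))),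
    (dI i k - dI i (k+1)) / (2 * Real.sqrt (p (k : ℕ) - p ((k : ℕ) + 1))), 0]

/-- derivative of the coefficients in the variable `q i` -/
def dlq (r : ℕ) (p q : ℕ → ℝ) (i : ℕ) : Px r := fun k =>
  ![(p k * dI i k - p (k+1) * dI i (k+1)) /
      (2 * Real.sqrt (p (k : ℕ) * q (k : ℕ) - p ((k : ℕ) + 1) * q ((k : ℕ) + 1))), 0,
    (dI i k - dI i (k+1)) / (2 * Real.sqrt (q (k : ℕ) - q ((k : ℕ) + 1)))]

theorem hasDerivAt_cv_p (p q : ℕ → ℝ) (i : ℕ) (hp : ∀ k ≤ r, 0 < p k - p (k+1))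
    (hpq : ∀ k ≤ r, 0 < p k * q k - p (k+1) * q (k+1)) :
    HasDerivAt (fun ρ => cv r (Function.update p i ρ) q) (dlp r p q i) (p i) := by
  rw [hasDerivAt_pi]
  intro k
  rw [hasDerivAt_pi]
  have hk : (k : ℕ) ≤ r := by omega
  have h1 := hasDerivAt_upd p i k (p i)
  have h2 := hasDerivAt_upd p i (k+1) (p i)
  intro a
  fin_cases a
  · exact hasDerivAt_sqrt_half ((h1.mul_const (q k)).sub (h2.mul_const (q (k+1))))
      (v := p k * q k - p (k+1) * q (k+1)) (by simp) (hpq k hk)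
  · exact hasDerivAt_sqrt_half (h1.sub h2) (v := p k - p (k+1)) (by simp) (hp k hk)
  · exact hasDerivAt_const _ _

theorem hasDerivAt_cv_q (p q : ℕ → ℝ) (i : ℕ) (hq : ∀ k ≤ r, 0 < q k - q (k+1))
    (hpq : ∀ k ≤ r, 0 < p k * q k - p (k+1) * q (k+1)) :
    HasDerivAt (fun ρ => cv r p (Function.update q i ρ)) (dlq r p q i) (q i) := by
  rw [hasDerivAt_pi]
  intro k
  rw [hasDerivAt_pi]
  have hk : (k : ℕ) ≤ r := by omega
  have h1 := hasDerivAt_upd q i k (q i)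
  have h2 := hasDerivAt_upd q i (k+1) (q i)
  intro a
  fin_cases a
  · exact hasDerivAt_sqrt_half ((h1.const_mul (p k)).sub (h2.const_mul (p (k+1))))
      (v := p k * q k - p (k+1) * q (k+1)) (by simp) (hpq k hk)
  · exact hasDerivAt_const _ _
  · exact hasDerivAt_sqrt_half (h1.sub h2) (v := q k - q (k+1)) (by simp) (hq k hk)

end fin

/-- `p,q`-derivatives of `ψ` at the `r`-th level of full lifting. -/
theorem rth_level_pq_derivatives
    (r m n l : ℕ) (hr : 1 ≤ r) (hm : 1 ≤ m) (hn : 1 ≤ n) (hl : 1 ≤ l)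
    (β s t : ℝ) (hβ : 0 < β) (hs : s ≠ 0) (ht : t ∈ Set.Ioo (0:ℝ) 1)
    (mv p q : ℕ → ℝ)
    (hm0 : mv 0 = 1) (hmr1 : mv (r+1) = 0) (hmpos : ∀ k, 1 ≤ k → k ≤ r → 0 < mv k)
    (hp0 : p 0 ≤ 1) (hpmono : ∀ k ≤ r, p (k+1) ≤ p k) (hpend : p (r+1) = 0)
    (hq0 : q 0 ≤ 1) (hqmono : ∀ k ≤ r, q (k+1) ≤ q k) (hqend : q (r+1) = 0)
    (x : Fin l → Fin n → ℝ) (y : Fin l → Fin m → ℝ)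
    (hx : ∀ i, x i ≠ 0) (hy : ∀ i, y i ≠ 0)
    (hpstrict : ∀ k < r, p (k+1) < p k) (hprpos : 0 < p r)
    (hqstrict : ∀ k < r, q (k+1) < q k) (hqrpos : 0 < q r)
    (hpqstrict : ∀ k ≤ r, p (k+1) * q (k+1) < p k * q k) :
    ∀ k1, 1 ≤ k1 → k1 ≤ r →
      HasDerivAt (fun ρ => psiR r 1 β s t mv (Function.update p k1 ρ) q x y)
        (Real.sign s * s * β / (2 * Real.sqrt (n : ℝ)) *
          (-((1 - t) * (mv k1 - mv (k1+1)) * EBrR r 1 β s t mv p q x y k1 (fun i1 i2 pp1 pp2 => nrm2 (x i1) * nrm2 (x pp1) * dotv (y pp2) (y i2)))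
            - t * q k1 * (mv k1 - mv (k1+1)) * EXR r 1 β s t mv p q x y k1)) (p k1)
      ∧
      HasDerivAt (fun ρ => psiR r 1 β s t mv p (Function.update q k1 ρ) x y)
        (Real.sign s * s * β / (2 * Real.sqrt (n : ℝ)) *
          (-((1 - t) * (mv k1 - mv (k1+1)) *
              EBrR r 1 β s t mv p q x y k1 (fun i1 i2 pp1 pp2 =>
                nrm2 (y i2) * nrm2 (y pp2) * dotv (x pp1) (x i1)))
            - t * p k1 * (mv k1 - mv (k1+1)) * EXR r 1 β s t mv p q x y k1)) (q k1) := by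
  intro k1 hk1 hk1r
  obtain ⟨k, rfl⟩ : ∃ k, k1 = k + 1 := ⟨k1 - 1, by omega⟩
  have hmv : ∀ k ≤ r, 0 < mv k := by
    intro k hk
    rcases Nat.eq_zero_or_pos k with h | h
    · rw [h, hm0]; exact one_pos
    · exact hmpos k h hk
  have hpd : ∀ k ≤ r, 0 < p k - p (k+1) := by
    intro k hk
    rcases Nat.lt_or_ge k r with h | h
    · linarith [hpstrict k h]
    · obtain rfl : k = r := by omega
      rw [hpend]; linarith
  have hqd : ∀ k ≤ r, 0 < q k - q (k+1) := by
    intro k hk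
    rcases Nat.lt_or_ge k r with h | h
    · linarith [hqstrict k h]
    · obtain rfl : k = r := by omega
      rw [hqend]; linarith
  have hpqd : ∀ k ≤ r, 0 < p k * q k - p (k+1) * q (k+1) := by
    intro k hk
    linarith [hpqstrict k hk]
  constructor
  · have h := psi_deriv2 r β s t mv x y hn hs hβ ht hl hm0 hmv hmr1 p q
      (fun ρ => Function.update p (k+1) ρ) (fun _ => q) (p (k+1)) (Function.update_eq_self _ _) rfl
      (dlp r p q (k+1)) k hk1r (hasDerivAt_cv_p r p q (k+1) hpd hpqd)
      (by
        intro j hj1 hj2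
        ext a
        fin_cases a <;> simp [dlp, dI, hj1, hj2])
      ![q (k+1), 1, 0]
      (by
        intro a
        have h1 := sqrt_half (a := q (k+1)) (hpqd (k+1) hk1r)
        have h2 := sqrt_half (a := 1) (hpd (k+1) hk1r)
        fin_cases a
        · simpa [dlp, dI, cv] using h1
        · simpa [dlp, dI, cv] using h2
        · simp [dlp, dI, cv])
      (by
        intro a
        have h1 := sqrt_half (a := - q (k+1)) (hpqd k (by omega))
        have h2 := sqrt_half (a := -1) (hpd k (by omega))
        rw [neg_div (2:ℝ)] at h1 h2
        fin_cases a
        · simpa [dlp, dI, cv] using h1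
        · simpa [dlp, dI, cv] using h2
        · simp [dlp, dI, cv])
    refine h.congr_deriv ?_
    simp only [Matrix.cons_val_zero, Matrix.cons_val_one, Matrix.cons_val]
    ring
  · have h := psi_deriv2 r β s t mv x y hn hs hβ ht hl hm0 hmv hmr1 p q
      (fun _ => p) (fun ρ => Function.update q (k+1) ρ) (q (k+1)) rfl (Function.update_eq_self _ _)
      (dlq r p q (k+1)) k hk1r (hasDerivAt_cv_q r p q (k+1) hqd hpqd)
      (by
        intro j hj1 hj2
        ext a
        fin_cases a <;> simp [dlq, dI, hj1, hj2])
      ![p (k+1), 0, 1]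
      (by
        intro a
        have h1 := sqrt_half (a := p (k+1)) (hpqd (k+1) hk1r)
        have h2 := sqrt_half (a := 1) (hqd (k+1) hk1r)
        fin_cases a
        · simpa [dlq, dI, cv] using h1
        · simp [dlq, dI, cv]
        · simpa [dlq, dI, cv] using h2)
      (by
        intro a
        have h1 := sqrt_half (a := - p (k+1)) (hpqd k (by omega))
        have h2 := sqrt_half (a := -1) (hqd k (by omega))
        rw [neg_div (2:ℝ)] at h1 h2
        fin_cases a
        · simpa [dlq, dI, cv] using h1
        · simp [dlq, dI, cv]
        · simpa [dlq, dI, cv] using h2)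
    refine h.congr_deriv ?_
    simp only [Matrix.cons_val_zero, Matrix.cons_val_one, Matrix.cons_val]
    ring

end

end SFLR
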